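/- arXiv:0708.2895 — 2 statements merged into one kernel-verified Lean document; each statement's English description precedes it below -/
import Mathlib

section
/- Let κ ≥ 1, let α be a complex random variable with κ-controlled second moment, let r ≥ 1 be an integer and ε > 0. Then there is a constant C = C(ε, r, κ) such that for every 0 < μ ≤ 1, all complex numbers v₁,…,v_r, and all positive integers k₁,…,k_r, one has P_μ(v₁^{k₁}⌢…⌢v_r^{k_r}) ≤ C·D(Q)^{−1+ε}, where v₁^{k₁}⌢…⌢v_r^{k_r} is the tuple in which v_i appears k_i times for each i, and Q := GAP((v₁,…,v_r), (√(μk₁),…,√(μk_r))). -/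
open MeasureTheory ProbabilityTheory Filter

noncomputable section

/-- The operator (spectral) norm of an `n × n` complex matrix, i.e. the supremum of `‖M v‖`
over unit vectors `v` in Euclidean space. -/
def opNorm {n : ℕ} (M : Matrix (Fin n) (Fin n) ℂ) : ℝ :=
  ‖(Matrix.toEuclideanCLM (𝕜 := ℂ) M : EuclideanSpace ℂ (Fin n) →L[ℂ] EuclideanSpace ℂ (Fin n))‖

/-- The least singular value of an `n × n` complex matrix: `σ_n(M) = inf_{‖v‖ = 1} ‖M v‖`. -/
def sigmaMin {n : ℕ} (M : Matrix (Fin n) (Fin n) ℂ) : ℝ :=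
  ⨅ v : {v : EuclideanSpace ℂ (Fin n) // ‖v‖ = 1},
    ‖Matrix.toEuclideanCLM (𝕜 := ℂ) M v.1‖

open Classical in
/-- The empirical spectral distribution of an `n × n` complex matrix:
`ESD M s t = (1/n) * #{eigenvalues λ (with multiplicity) : Re λ ≤ s, Im λ ≤ t}`,
eigenvalues with multiplicity being the roots of the characteristic polynomial. -/
def ESD {n : ℕ} (M : Matrix (Fin n) (Fin n) ℂ) (s t : ℝ) : ℝ :=
  ((M.charpoly.roots.filter (fun z => z.re ≤ s ∧ z.im ≤ t)).card : ℝ) / n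

/-- The distribution function of the uniform probability measure on the unit disk:
`μ_∞(s,t) = (1/π) · mes {z : |z| ≤ 1, Re z ≤ s, Im z ≤ t}`. -/
def unifDiskCDF (s t : ℝ) : ℝ :=
  (volume {z : ℂ | ‖z‖ ≤ 1 ∧ z.re ≤ s ∧ z.im ≤ t}).toReal / Real.pi

/-- The law (on `ℂ`) of a Bernoulli random variable which equals `1` with probability `ρ`
and `0` with probability `1 - ρ`. -/
def bernoulliLawC (ρ : ℝ) : Measure ℂ :=
  ENNReal.ofReal ρ • Measure.dirac 1 + ENNReal.ofReal (1 - ρ) • Measure.dirac 0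

/-- The law of `α · I_μ`, the product of a random variable with law `ν` and an independent
Bernoulli variable equal to `1` with probability `μ` and `0` otherwise. -/
def bernoulliMix (ν : Measure ℂ) (μ : ℝ) : Measure ℂ :=
  ENNReal.ofReal μ • ν + ENNReal.ofReal (1 - μ) • Measure.dirac 0

/-- The law of `α^{(μ)} := (α₁ - α₂) · I_{μ/2}` where `α₁, α₂` are i.i.d. with law `ν` and
`I_{μ/2}` is an independent Bernoulli variable equal to `1` with probability `μ/2`. -/
def diffLaw (ν : Measure ℂ) (μ : ℝ) : Measure ℂ :=
  ENNReal.ofReal (μ / 2) • Measure.map (fun p : ℂ × ℂ => p.1 - p.2) (ν.prod ν)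
    + ENNReal.ofReal (1 - μ / 2) • Measure.dirac 0

/-- The concentration probability `P_μ(v) := E exp(-π |W_{α^{(μ)}}(v)|²)`, where
`W_{α^{(μ)}}(v) = ∑ i, v i · x i` with `x i` i.i.d. copies of `α^{(μ)}` and `ν` is the law
of `α`. -/
def concProb {ι : Type*} [Fintype ι] (ν : Measure ℂ) (μ : ℝ) (v : ι → ℂ) : ℝ :=
  ∫ x, Real.exp (-Real.pi * ‖∑ i, v i * x i‖ ^ 2) ∂(Measure.pi fun _ : ι => diffLaw ν μ)

/-- The small ball probability `p_{r,α}(v) := sup_z P(W_α(v) ∈ B(z,r))`, where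
`W_α(v) = ∑ i, v i · x i` with `x i` i.i.d. copies of a random variable with law `ν`. -/
def smallBall {ι : Type*} [Fintype ι] (ν : Measure ℂ) (v : ι → ℂ) (r : ℝ) : ℝ :=
  ⨆ z : ℂ, ((Measure.pi fun _ : ι => ν) {x | dist (∑ i, v i * x i) z ≤ r}).toReal

/-- The characteristic function `f(z) := |E e(Re(α z))|²` where `e(t) = e^{2π√-1 t}` and
`ν` is the law of `α`. -/
def charFn (ν : Measure ℂ) (z : ℂ) : ℝ :=
  ‖∫ w, Complex.exp (2 * Real.pi * Complex.I * ((w * z).re : ℂ)) ∂ν‖ ^ 2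

/-- The `α`-norm `‖w‖_α := (E ‖Re(w (α₁ - α₂))‖_{ℝ/ℤ}²)^{1/2}` where `α₁, α₂` are i.i.d.
with law `ν`, and `‖t‖_{ℝ/ℤ} = |t - round t|` is the distance to the nearest integer. -/
def alphaNorm (ν : Measure ℂ) (w : ℂ) : ℝ :=
  Real.sqrt (∫ p : ℂ × ℂ,
    |(w * (p.1 - p.2)).re - (round ((w * (p.1 - p.2)).re) : ℝ)| ^ 2 ∂(ν.prod ν))

/-- The symmetric generalized arithmetic progression with generators `v i` and dimensions
`L i`: the set of `∑ i, m i • v i` with `m i ∈ ℤ`, `|m i| ≤ L i`. -/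
def GAPset {r : ℕ} (v : Fin r → ℂ) (L : Fin r → ℝ) : Set ℂ :=
  {z | ∃ m : Fin r → ℤ, (∀ i, |(m i : ℝ)| ≤ L i) ∧ z = ∑ i, (m i : ℂ) * v i}

/-- The dispersion `D(Q) := #Q / #(Q ∩ B(0,1))` of a finite set `Q ⊆ ℂ`. -/
def dispersion (Q : Set ℂ) : ℝ :=
  (Q.ncard : ℝ) / ((Q ∩ Metric.closedBall 0 1).ncard : ℝ)

/-- A complex random variable `α` has `κ`-controlled second moment if `κ ≥ 1`,
`E|α|² ≤ κ`, and `E[(Re(zα - w))² 1_{|α| ≤ κ}] ≥ Re(z)²/κ` for all `z w : ℂ`. -/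
def HasControlledSecondMoment {Ω : Type*} [MeasureSpace Ω] (α : Ω → ℂ) (κ : ℝ) : Prop :=
  1 ≤ κ ∧ Integrable (fun ω => ‖α ω‖ ^ 2) ∧ (∫ ω, ‖α ω‖ ^ 2) ≤ κ ∧
    ∀ z w : ℂ, z.re ^ 2 / κ ≤ ∫ ω in {ω | ‖α ω‖ ≤ κ}, ((z * α ω - w).re) ^ 2

end

namespace LittlewoodOfford

lemma one_sub_cos_eq (x : ℝ) : 1 - Real.cos x = 2 * Real.sin (x / 2) ^ 2 := by
  have h := Real.cos_two_mul (x / 2)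
  have h2 := Real.sin_sq_add_cos_sq (x / 2)
  rw [mul_div_cancel₀ x two_ne_zero] at h
  linarith

lemma abs_sin_add_le (x y : ℝ) : |Real.sin (x + y)| ≤ |Real.sin x| + |Real.sin y| := by
  rw [Real.sin_add]
  calc _ ≤ |Real.sin x * Real.cos y| + |Real.cos x * Real.sin y| := abs_add_le _ _
    _ ≤ _ := by
      rw [abs_mul, abs_mul]
      have := Real.abs_cos_le_one x
      have := Real.abs_cos_le_one y
      gcongr
      · exact mul_le_of_le_one_right (abs_nonneg _) ‹_›
      · exact mul_le_of_le_one_left (abs_nonneg _) ‹_›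

lemma abs_sin_natCast_mul_le (n : ℕ) (x : ℝ) : |Real.sin (n * x)| ≤ n * |Real.sin x| := by
  induction n with
  | zero => simp
  | succ n ih =>
    push_cast
    rw [add_mul, add_mul, one_mul, one_mul]
    exact (abs_sin_add_le _ _).trans (by gcongr)

lemma abs_sin_intCast_mul_le (m : ℤ) (x : ℝ) : |Real.sin (m * x)| ≤ |(m : ℝ)| * |Real.sin x| := by
  obtain ⟨n, rfl | rfl⟩ := m.eq_nat_or_neg
  · simpa using abs_sin_natCast_mul_le n x
  · simpa using abs_sin_natCast_mul_le n x

lemma abs_sin_sum_le {ι : Type*} (s : Finset ι) (f : ι → ℝ) :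
    |Real.sin (∑ i ∈ s, f i)| ≤ ∑ i ∈ s, |Real.sin (f i)| := by
  classical
  induction s using Finset.induction_on with
  | empty => simp
  | insert a s ha ih =>
    rw [Finset.sum_insert ha, Finset.sum_insert ha]
    exact (abs_sin_add_le _ _).trans (by gcongr)

lemma one_sub_cos_sum_le {r : ℕ} (m : Fin r → ℤ) (θ : Fin r → ℝ) :
    1 - Real.cos (∑ i, m i * θ i) ≤ r * ∑ i, (m i : ℝ) ^ 2 * (1 - Real.cos (θ i)) := by
  have h1 : |Real.sin (∑ i, m i * (θ i / 2))| ≤ ∑ i, |(m i : ℝ)| * |Real.sin (θ i / 2)| :=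
    (abs_sin_sum_le _ _).trans (Finset.sum_le_sum fun i _ => abs_sin_intCast_mul_le _ _)
  have h2 : Real.sin (∑ i, m i * (θ i / 2)) ^ 2 ≤ (∑ i, |(m i : ℝ)| * |Real.sin (θ i / 2)|) ^ 2 := by
    rw [← sq_abs]; gcongr
  have h3 := sq_sum_le_card_mul_sum_sq (s := Finset.univ)
    (f := fun i => |(m i : ℝ)| * |Real.sin (θ i / 2)|)
  rw [one_sub_cos_eq, Finset.sum_div]
  simp only [one_sub_cos_eq, ← mul_div_assoc] at *
  simp only [mul_pow, sq_abs, Finset.card_univ, Fintype.card_fin] at h3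
  calc _ ≤ 2 * (r * ∑ i, (m i : ℝ) ^ 2 * Real.sin (θ i / 2) ^ 2) := by linarith
    _ = _ := by
      simp only [Finset.mul_sum]
      exact Finset.sum_congr rfl fun i _ => by ring

lemma norm_character (t : ℝ) : ‖Complex.exp (2 * Real.pi * Complex.I * (t : ℂ))‖ = 1 := by
  rw [show 2 * Real.pi * Complex.I * (t : ℂ) = ((2 * Real.pi * t : ℝ) : ℂ) * Complex.I by
    push_cast; ring, Complex.norm_exp_ofReal_mul_I]

/-- The Gaussian is its own Fourier transform on `ℂ`. -/
lemma integral_fourier_gaussian (w : ℂ) :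
    ∫ ξ : ℂ, Complex.exp (2 * Real.pi * Complex.I * ((w * ξ).re : ℂ)) *
      (Real.exp (-Real.pi * ‖ξ‖ ^ 2) : ℂ) = (Real.exp (-Real.pi * ‖w‖ ^ 2) : ℂ) := by
  have h := GaussianFourier.integral_cexp_neg_mul_sq_norm_add (V := ℂ) (b := Real.pi)
    (by simpa using Real.pi_pos) (2 * Real.pi * Complex.I) (starRingEnd ℂ w)
  have hp : (Real.pi : ℂ) ≠ 0 := by exact_mod_cast Real.pi_ne_zero
  rw [div_self hp, Complex.one_cpow, one_mul] at h
  convert h using 1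
  · refine integral_congr_ae (Eventually.of_forall fun ξ => ?_)
    simp only
    rw [Complex.ofReal_exp, ← Complex.exp_add]
    congr 1
    rw [Complex.inner]
    push_cast
    rw [Complex.conj_conj, mul_comm ξ w]
    ring
  · rw [Complex.ofReal_exp]
    congr 1
    push_cast
    rw [mul_pow, mul_pow, Complex.I_sq, RCLike.norm_conj]
    field_simp
    ring

lemma integrable_gaussian : Integrable (fun ξ : ℂ => Real.exp (-Real.pi * ‖ξ‖ ^ 2)) := by
  have h := GaussianFourier.integrable_cexp_neg_mul_sq_norm_add (V := ℂ) (b := Real.pi)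
    (by simpa using Real.pi_pos) 0 0
  refine h.norm.congr (Eventually.of_forall fun ξ => ?_)
  simp [Complex.norm_exp, ← Complex.ofReal_pow]

lemma integral_gaussian_one : ∫ ξ : ℂ, Real.exp (-Real.pi * ‖ξ‖ ^ 2) = 1 := by
  have h := integral_fourier_gaussian 0
  simp only [zero_mul, Complex.zero_re, Complex.ofReal_zero, mul_zero, Complex.exp_zero, one_mul,
    norm_zero] at h
  rw [integral_complex_ofReal] at h
  have : (0:ℝ) ^ 2 = 0 := by norm_num
  rw [this, mul_zero, Real.exp_zero] at h
  exact_mod_cast h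

lemma integral_cos_gaussian (w : ℂ) :
    ∫ ξ : ℂ, Real.cos (2 * Real.pi * (w * ξ).re) * Real.exp (-Real.pi * ‖ξ‖ ^ 2) =
      Real.exp (-Real.pi * ‖w‖ ^ 2) := by
  have h := congrArg Complex.re (integral_fourier_gaussian w)
  rw [Complex.ofReal_re] at h
  rw [← h]
  have hi : Integrable (fun ξ : ℂ => Complex.exp (2 * Real.pi * Complex.I * ((w * ξ).re : ℂ)) *
      (Real.exp (-Real.pi * ‖ξ‖ ^ 2) : ℂ)) := by
    refine integrable_gaussian.mono' (by fun_prop) (Eventually.of_forall fun ξ => ?_)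
    rw [norm_mul, norm_character, one_mul, Complex.norm_real, Real.norm_of_nonneg (Real.exp_pos _).le]
  have := integral_re hi
  simp only [RCLike.re_eq_complex_re] at this
  rw [← this]
  refine integral_congr_ae (Eventually.of_forall fun ξ => ?_)
  simp only [Complex.re_mul_ofReal]
  congr 1
  rw [show 2 * Real.pi * Complex.I * ((w * ξ).re : ℂ) =
    ((2 * Real.pi * (w * ξ).re : ℝ) : ℂ) * Complex.I by push_cast; ring,
    Complex.exp_ofReal_mul_I_re]


/-- The defect `E (1 - cos (2π Re (z (α₁ - α₂))))` of the characteristic function at `z`. -/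
noncomputable def defect (ν : Measure ℂ) (z : ℂ) : ℝ :=
  ∫ p : ℂ × ℂ, (1 - Real.cos (2 * Real.pi * (z * (p.1 - p.2)).re)) ∂(ν.prod ν)

lemma integrable_one_sub_cos {X : Type*} [MeasurableSpace X] (η : Measure X) [IsFiniteMeasure η]
    {f : X → ℝ} (hf : Measurable f) : Integrable (fun x => 1 - Real.cos (f x)) η := by
  refine (integrable_const (2 : ℝ)).mono' (by fun_prop) (Eventually.of_forall fun x => ?_)
  have h1 := Real.cos_le_one (f x)
  have h2 := Real.neg_one_le_cos (f x)
  rw [Real.norm_of_nonneg (by linarith)]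
  linarith

lemma integrable_character {X : Type*} [MeasurableSpace X] (η : Measure X) [IsFiniteMeasure η]
    {f : X → ℝ} (hf : Measurable f) :
    Integrable (fun x => Complex.exp (2 * Real.pi * Complex.I * (f x : ℂ))) η := by
  refine (integrable_const (1 : ℝ)).mono' (by fun_prop) (Eventually.of_forall fun x => ?_)
  rw [norm_character]

lemma defect_nonneg (ν : Measure ℂ) (z : ℂ) : 0 ≤ defect ν z :=
  integral_nonneg fun p => by simpa using Real.cos_le_one _

lemma defect_le_two (ν : Measure ℂ) [IsProbabilityMeasure ν] (z : ℂ) : defect ν z ≤ 2 := by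
  refine (integral_mono (integrable_one_sub_cos _ (by fun_prop)) (integrable_const (2 : ℝ))
    fun p => ?_).trans (by simp)
  have := Real.neg_one_le_cos (2 * Real.pi * (z * (p.1 - p.2)).re)
  simp only
  linarith

lemma integral_character_sub (ν : Measure ℂ) [IsProbabilityMeasure ν] (z : ℂ) :
    ∫ p : ℂ × ℂ, Complex.exp (2 * Real.pi * Complex.I * ((z * (p.1 - p.2)).re : ℂ)) ∂(ν.prod ν) =
      ((1 - defect ν z : ℝ) : ℂ) := by
  have hi := integrable_character (ν.prod ν) (f := fun p : ℂ × ℂ => (z * (p.1 - p.2)).re)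
    (by fun_prop)
  have hE : ∀ t : ℝ, Complex.exp (2 * Real.pi * Complex.I * (t : ℂ)) =
      (Real.cos (2 * Real.pi * t) : ℂ) + (Real.sin (2 * Real.pi * t) : ℂ) * Complex.I := by
    intro t
    rw [show 2 * Real.pi * Complex.I * (t : ℂ) = ((2 * Real.pi * t : ℝ) : ℂ) * Complex.I by
      push_cast; ring, Complex.exp_mul_I, Complex.ofReal_cos, Complex.ofReal_sin]
  apply Complex.ext
  · have h := integral_re hi
    simp only [RCLike.re_eq_complex_re] at h
    rw [← h, Complex.ofReal_re, defect, integral_sub (integrable_const _)]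
    · simp only [integral_const, probReal_univ, smul_eq_mul, mul_one, sub_sub_cancel]
      refine integral_congr_ae (Eventually.of_forall fun p => ?_)
      simp only [hE]
      simp [-Complex.ofReal_cos, -Complex.ofReal_sin]
    · refine (integrable_const (1 : ℝ)).mono' (by fun_prop) (Eventually.of_forall fun x => ?_)
      exact Real.abs_cos_le_one _
  · have h := integral_im hi
    simp only [RCLike.im_eq_complex_im] at h
    rw [← h, Complex.ofReal_im]
    simp only [hE]
    simp only [Complex.add_im, Complex.ofReal_im, Complex.mul_I_im, Complex.ofReal_re, zero_add]
    have hs := integral_prod_swap (μ := ν) (ν := ν)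
      (fun p : ℂ × ℂ => Real.sin (2 * Real.pi * (z * (p.1 - p.2)).re))
    have hn : (fun p : ℂ × ℂ => Real.sin (2 * Real.pi * (z * (p.swap.1 - p.swap.2)).re)) =
        fun p => -Real.sin (2 * Real.pi * (z * (p.1 - p.2)).re) := by
      funext p
      rw [← Real.sin_neg, ← mul_neg, ← Complex.neg_re, ← mul_neg, neg_sub]
      rfl
    rw [hn, integral_neg] at hs
    linarith

instance isProbabilityMeasure_map_sub (ν : Measure ℂ) [IsProbabilityMeasure ν] :
    IsProbabilityMeasure (Measure.map (fun p : ℂ × ℂ => p.1 - p.2) (ν.prod ν)) :=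
  Measure.isProbabilityMeasure_map (by fun_prop)

lemma isProbabilityMeasure_diffLaw (ν : Measure ℂ) [IsProbabilityMeasure ν] {μ : ℝ} (h0 : 0 < μ)
    (h1 : μ ≤ 1) : IsProbabilityMeasure (diffLaw ν μ) := by
  constructor
  simp only [diffLaw, Measure.coe_add, Measure.coe_smul, Pi.add_apply, Pi.smul_apply, measure_univ,
    smul_eq_mul, mul_one]
  rw [← ENNReal.ofReal_add (by linarith) (by linarith)]
  simp

lemma integral_character_diffLaw (ν : Measure ℂ) [IsProbabilityMeasure ν] {μ : ℝ} (h0 : 0 < μ)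
    (h1 : μ ≤ 1) (z : ℂ) :
    ∫ x, Complex.exp (2 * Real.pi * Complex.I * ((z * x).re : ℂ)) ∂(diffLaw ν μ) =
      ((1 - μ / 2 * defect ν z : ℝ) : ℂ) := by
  have hm : Measurable fun x : ℂ => (z * x).re := by fun_prop
  rw [diffLaw, integral_add_measure
    ((integrable_character _ hm).smul_measure ENNReal.ofReal_ne_top)
    ((integrable_character _ hm).smul_measure ENNReal.ofReal_ne_top),
    integral_smul_measure, integral_smul_measure, integral_dirac,
    integral_map (by fun_prop) (by fun_prop), integral_character_sub,
    ENNReal.toReal_ofReal (by linarith), ENNReal.toReal_ofReal (by linarith)]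
  simp
  ring

lemma norm_integral_character_diffLaw_le (ν : Measure ℂ) [IsProbabilityMeasure ν] {μ : ℝ}
    (h0 : 0 < μ) (h1 : μ ≤ 1) (z : ℂ) :
    ‖∫ x, Complex.exp (2 * Real.pi * Complex.I * ((z * x).re : ℂ)) ∂(diffLaw ν μ)‖ ≤
      Real.exp (-(μ / 2 * defect ν z)) := by
  rw [integral_character_diffLaw ν h0 h1, Complex.norm_real, Real.norm_of_nonneg]
  · linarith [Real.add_one_le_exp (-(μ / 2 * defect ν z))]
  · nlinarith [defect_nonneg ν z, defect_le_two ν z]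

lemma concProb_eq {ι : Type*} [Fintype ι] (ν : Measure ℂ) [IsProbabilityMeasure ν] {μ : ℝ}
    (h0 : 0 < μ) (h1 : μ ≤ 1) (v : ι → ℂ) :
    (concProb ν μ v : ℂ) = ∫ ξ : ℂ, (∏ i, ∫ x, Complex.exp (2 * Real.pi * Complex.I *
      ((v i * ξ * x).re : ℂ)) ∂(diffLaw ν μ)) * (Real.exp (-Real.pi * ‖ξ‖ ^ 2) : ℂ) := by
  have := isProbabilityMeasure_diffLaw ν h0 h1
  rw [concProb, ← integral_complex_ofReal,
    integral_congr_ae (Eventually.of_forall fun x => (integral_fourier_gaussian _).symm),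
    integral_integral_swap]
  · refine integral_congr_ae (Eventually.of_forall fun ξ => ?_)
    simp only
    rw [integral_mul_const, ← integral_fintype_prod_eq_prod]
    congr 1
    refine integral_congr_ae (Eventually.of_forall fun x => ?_)
    simp only
    rw [← Complex.exp_sum, ← Finset.mul_sum, ← Complex.ofReal_sum, ← Complex.re_sum, Finset.sum_mul]
    simp only [mul_right_comm]
  · have hg := (integrable_gaussian.comp_snd (Measure.pi fun _ : ι => diffLaw ν μ))
    refine hg.mono' (Measurable.aestronglyMeasurable ?_) (Eventually.of_forall fun p => ?_)
    · simp only [Function.uncurry_def]; fun_prop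
    · simp only [Function.uncurry_def]
      rw [norm_mul, norm_character, one_mul, Complex.norm_real,
        Real.norm_of_nonneg (Real.exp_pos _).le]

lemma concProb_le {ι : Type*} [Fintype ι] (ν : Measure ℂ) [IsProbabilityMeasure ν] {μ : ℝ}
    (h0 : 0 < μ) (h1 : μ ≤ 1) (v : ι → ℂ) (B : ℂ → ℝ)
    (hB : ∀ ξ, Real.exp (-(1 / 2 * ∑ i, μ * defect ν (v i * ξ))) ≤ B ξ)
    (hBi : Integrable fun ξ => B ξ * Real.exp (-Real.pi * ‖ξ‖ ^ 2)) :
    concProb ν μ v ≤ ∫ ξ, B ξ * Real.exp (-Real.pi * ‖ξ‖ ^ 2) := by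
  calc concProb ν μ v ≤ ‖(concProb ν μ v : ℂ)‖ := by
        rw [Complex.norm_real]; exact Real.le_norm_self _
    _ ≤ _ := by
      rw [concProb_eq ν h0 h1]
      refine norm_integral_le_of_norm_le hBi (Eventually.of_forall fun ξ => ?_)
      rw [norm_mul, Complex.norm_real, Real.norm_of_nonneg (Real.exp_pos _).le, norm_prod]
      gcongr
      refine (Finset.prod_le_prod (fun _ _ => norm_nonneg _)
        fun i _ => norm_integral_character_diffLaw_le ν h0 h1 _).trans (le_trans (le_of_eq ?_) (hB ξ))
      rw [← Real.exp_sum, Finset.mul_sum, ← Finset.sum_neg_distrib]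
      congr 1
      exact Finset.sum_congr rfl fun i _ => by ring


lemma controlled_map {Ω : Type*} [MeasureSpace Ω] {α : Ω → ℂ} (hα : Measurable α) {κ : ℝ}
    (h : HasControlledSecondMoment α κ) (z w : ℂ) :
    z.re ^ 2 / κ ≤ ∫ x in {x : ℂ | ‖x‖ ≤ κ}, ((z * x - w).re) ^ 2 ∂(Measure.map α ℙ) := by
  rw [setIntegral_map (measurableSet_le (by fun_prop) (by fun_prop)) (by fun_prop) (by fun_prop)]
  exact h.2.2.2 z w

/-- With probability bounded below, `α₁ - α₂` is bounded away from `0`. -/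
lemma prob_diff_ge (ν : Measure ℂ) [IsProbabilityMeasure ν] {κ : ℝ} (hκ : 1 ≤ κ)
    (h : ∀ z w : ℂ, z.re ^ 2 / κ ≤ ∫ x in {x : ℂ | ‖x‖ ≤ κ}, ((z * x - w).re) ^ 2 ∂ν) {c : ℝ}
    (hc : c ^ 2 = 1 / (2 * κ ^ 4)) :
    1 / (8 * κ ^ 6) ≤ (ν.prod ν).real {p | c ≤ ‖p.1 - p.2‖} := by
  have hκ0 : 0 < κ := by linarith
  set B : Set ℂ := {x : ℂ | ‖x‖ ≤ κ} with hB
  set A : Set (ℂ × ℂ) := {p | c ≤ ‖p.1 - p.2‖} with hA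
  have hBm : MeasurableSet B := measurableSet_le (by fun_prop) (by fun_prop)
  have hAm : MeasurableSet A := measurableSet_le (by fun_prop) (by fun_prop)
  set m := ν.restrict B with hm
  have hmB : ∀ᵐ x ∂m, ‖x‖ ≤ κ := ae_restrict_mem hBm
  have hre : ∀ x : ℂ, ‖x‖ ≤ κ → x.re ^ 2 ≤ κ ^ 2 := fun x hx =>
    sq_le_sq' (by linarith [neg_abs_le x.re, Complex.abs_re_le_norm x])
      ((le_abs_self _).trans ((Complex.abs_re_le_norm x).trans hx))
  have hb : 1 / κ ≤ κ ^ 2 * m.real Set.univ := by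
    have h1 := h 1 0
    simp only [Complex.one_re, one_pow, one_mul, sub_zero] at h1
    refine h1.trans ((integral_mono_of_nonneg (Eventually.of_forall fun x => sq_nonneg _)
      (integrable_const (κ ^ 2)) ?_).trans (by simp [mul_comm]))
    filter_upwards [hmB] with x hx using hre x hx
  set f : ℂ → ℂ → ℝ := fun w x => c ^ 2 + 4 * κ ^ 2 * A.indicator 1 (x, w) with hf
  have hind : Integrable (A.indicator (1 : ℂ × ℂ → ℝ)) (m.prod m) :=
    (integrable_const (1 : ℝ)).indicator hAm
  have hind' : Integrable (fun p : ℂ × ℂ => A.indicator (1 : ℂ × ℂ → ℝ) (p.2, p.1)) (m.prod m) :=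
    hind.swap
  have hfi : Integrable (Function.uncurry f) (m.prod m) :=
    (integrable_const (c ^ 2)).add (hind'.const_mul (4 * κ ^ 2))
  have hw : ∀ᵐ w ∂m, 1 / κ ≤ ∫ x, f w x ∂m := by
    filter_upwards [hmB, hfi.prod_right_ae] with w hw hwi
    have h1 := h 1 w
    simp only [Complex.one_re, one_pow, one_mul] at h1
    refine h1.trans (integral_mono_of_nonneg (Eventually.of_forall fun x => sq_nonneg _) hwi ?_)
    filter_upwards [hmB] with x hx
    simp only [hf]
    by_cases hxw : (x, w) ∈ A
    · rw [Set.indicator_of_mem hxw]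
      have h2 := hre x hx
      have h3 := hre w hw
      simp only [Complex.sub_re, Pi.one_apply]
      nlinarith [sq_nonneg (x.re + w.re), sq_nonneg c]
    · rw [Set.indicator_of_notMem hxw]
      have h2 : ‖x - w‖ < c := by simpa [hA] using hxw
      have h3 := Complex.abs_re_le_norm (x - w)
      have h4 : |(x - w).re| ^ 2 ≤ c ^ 2 := by gcongr; linarith
      rw [sq_abs] at h4
      linarith
  have h5 : m.real Set.univ * (1 / κ) ≤ ∫ w, ∫ x, f w x ∂m ∂m := by
    calc m.real Set.univ * (1 / κ) = ∫ _, 1 / κ ∂m := by simp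
      _ ≤ _ := integral_mono_ae (integrable_const _) hfi.integral_prod_left hw
  have h6 : ∫ w, ∫ x, f w x ∂m ∂m ≤ c ^ 2 + 4 * κ ^ 2 * (ν.prod ν).real A := by
    rw [integral_integral hfi]
    simp only [hf]
    have hs : ∫ p : ℂ × ℂ, A.indicator (1 : ℂ × ℂ → ℝ) (p.2, p.1) ∂(m.prod m) =
        (m.prod m).real A :=
      (integral_prod_swap (A.indicator (1 : ℂ × ℂ → ℝ))).trans (integral_indicator_one hAm)
    rw [integral_add (integrable_const _) (hind'.const_mul _), integral_const_mul, hs]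
    have hle : m.prod m ≤ ν.prod ν := Measure.prod_mono Measure.restrict_le_self Measure.restrict_le_self
    have h7 : (m.prod m).real A ≤ (ν.prod ν).real A :=
      ENNReal.toReal_mono (measure_ne_top _ _) (hle A)
    have h8 : (m.prod m).real Set.univ ≤ 1 := by
      simpa [Measure.real] using ENNReal.toReal_mono (measure_ne_top _ _) (hle Set.univ)
    simp only [integral_const, smul_eq_mul]
    have : 0 ≤ c ^ 2 := sq_nonneg c
    gcongr
    nlinarith
  have h9 : 1 / κ ^ 4 ≤ m.real Set.univ * (1 / κ) := by
    have : 1 / κ ^ 3 ≤ m.real Set.univ := by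
      rw [div_le_iff₀ (by positivity)] at hb ⊢
      nlinarith
    calc 1 / κ ^ 4 = 1 / κ ^ 3 * (1 / κ) := by field_simp
      _ ≤ _ := by gcongr
  have h10 : 1 / (2 * κ ^ 4) ≤ 4 * κ ^ 2 * (ν.prod ν).real A := by
    have : 1 / κ ^ 4 = 1 / (2 * κ ^ 4) + 1 / (2 * κ ^ 4) := by field_simp; norm_num
    linarith
  rw [div_le_iff₀ (by positivity)] at h10 ⊢
  linarith

/-- The sum of the characters `ξ ↦ e(Re (q y ξ))`, `q ∈ S`, squared in modulus and averaged
over `y = p.1 - p.2`. -/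
noncomputable def kernel (ρ : Measure (ℂ × ℂ)) (S : Finset ℂ) (ξ : ℂ) : ℝ :=
  ∑ q ∈ S, ∑ q' ∈ S, ∫ p : ℂ × ℂ, Real.cos (2 * Real.pi * ((q - q') * (p.1 - p.2) * ξ).re) ∂ρ

lemma integrable_cos {X : Type*} [MeasurableSpace X] (η : Measure X) [IsFiniteMeasure η]
    {f : X → ℝ} (hf : Measurable f) : Integrable (fun x => Real.cos (f x)) η :=
  (integrable_const (1 : ℝ)).mono' (by fun_prop)
    (Eventually.of_forall fun _ => Real.abs_cos_le_one _)

lemma kernel_nonneg (ρ : Measure (ℂ × ℂ)) [IsFiniteMeasure ρ] (S : Finset ℂ) (ξ : ℂ) :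
    0 ≤ kernel ρ S ξ := by
  have hi : ∀ q q' : ℂ, Integrable
      (fun p : ℂ × ℂ => Real.cos (2 * Real.pi * ((q - q') * (p.1 - p.2) * ξ).re)) ρ :=
    fun q q' => integrable_cos ρ (by fun_prop)
  rw [kernel, Finset.sum_congr rfl fun q _ => (integral_finsetSum S fun q' _ => hi q q').symm,
    ← integral_finsetSum S fun q _ => integrable_finsetSum S fun q' _ => hi q q']
  refine integral_nonneg fun p => ?_
  have h : ∀ q q' : ℂ, Real.cos (2 * Real.pi * ((q - q') * (p.1 - p.2) * ξ).re) =
      Real.cos (2 * Real.pi * (q * (p.1 - p.2) * ξ).re) *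
        Real.cos (2 * Real.pi * (q' * (p.1 - p.2) * ξ).re) +
      Real.sin (2 * Real.pi * (q * (p.1 - p.2) * ξ).re) *
        Real.sin (2 * Real.pi * (q' * (p.1 - p.2) * ξ).re) := by
    intro q q'
    rw [← Real.cos_sub, ← mul_sub, ← Complex.sub_re, sub_mul, sub_mul]
  simp only [h, Finset.sum_add_distrib, ← Finset.sum_mul_sum, Pi.zero_apply]
  nlinarith

lemma integrable_cos_gaussian_prod (ρ : Measure (ℂ × ℂ)) [IsFiniteMeasure ρ] (w : ℂ) :
    Integrable (fun x : (ℂ × ℂ) × ℂ => Real.cos (2 * Real.pi * (w * (x.1.1 - x.1.2) * x.2).re) *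
      Real.exp (-Real.pi * ‖x.2‖ ^ 2)) (ρ.prod volume) := by
  refine (integrable_gaussian.comp_snd ρ).mono' (by fun_prop) (Eventually.of_forall fun x => ?_)
  rw [norm_mul, Real.norm_of_nonneg (Real.exp_pos _).le]
  exact mul_le_of_le_one_left (Real.exp_pos _).le (Real.abs_cos_le_one _)

lemma integrable_kernel_term (ρ : Measure (ℂ × ℂ)) [IsFiniteMeasure ρ] (w : ℂ) :
    Integrable (fun ξ : ℂ => (∫ p : ℂ × ℂ, Real.cos (2 * Real.pi * (w * (p.1 - p.2) * ξ).re) ∂ρ) *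
      Real.exp (-Real.pi * ‖ξ‖ ^ 2)) := by
  simp only [← integral_mul_const]
  exact (integrable_cos_gaussian_prod ρ w).integral_prod_right

lemma integrable_kernel (ρ : Measure (ℂ × ℂ)) [IsFiniteMeasure ρ] (S : Finset ℂ) :
    Integrable (fun ξ : ℂ => kernel ρ S ξ * Real.exp (-Real.pi * ‖ξ‖ ^ 2)) := by
  simp only [kernel, Finset.sum_mul]
  exact integrable_finsetSum S fun q _ => integrable_finsetSum S fun q' _ =>
    integrable_kernel_term ρ (q - q')

lemma integral_kernel_le (ρ : Measure (ℂ × ℂ)) [IsFiniteMeasure ρ] (hρ : ρ.real Set.univ ≤ 1)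
    {c : ℝ} (hc : 0 ≤ c) (hρc : ∀ᵐ p ∂ρ, c ≤ ‖p.1 - p.2‖) (S : Finset ℂ) :
    ∫ ξ : ℂ, kernel ρ S ξ * Real.exp (-Real.pi * ‖ξ‖ ^ 2) ≤
      ∑ q ∈ S, ∑ q' ∈ S, Real.exp (-(Real.pi * c ^ 2 * ‖q - q'‖ ^ 2)) := by
  simp only [kernel, Finset.sum_mul]
  rw [integral_finsetSum S fun q _ => integrable_finsetSum S fun q' _ =>
    integrable_kernel_term ρ (q - q')]
  refine Finset.sum_le_sum fun q _ => ?_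
  rw [integral_finsetSum S fun q' _ => integrable_kernel_term ρ (q - q')]
  refine Finset.sum_le_sum fun q' _ => ?_
  simp only [← integral_mul_const]
  rw [← integral_integral_swap (integrable_cos_gaussian_prod ρ (q - q'))]
  simp only [integral_cos_gaussian]
  refine (integral_mono_of_nonneg (Eventually.of_forall fun p => (Real.exp_pos _).le)
    (integrable_const (Real.exp (-(Real.pi * c ^ 2 * ‖q - q'‖ ^ 2)))) ?_).trans ?_
  · filter_upwards [hρc] with p hp
    rw [norm_mul, mul_pow, neg_mul, mul_assoc, mul_comm (c ^ 2)]
    have := Real.pi_pos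
    gcongr
  · rw [integral_const, smul_eq_mul]
    exact mul_le_of_le_one_left (Real.exp_pos _).le hρ

lemma le_integral_cos {r : ℕ} (ν : Measure ℂ) [IsProbabilityMeasure ν] (A : Set (ℂ × ℂ))
    (v : Fin r → ℂ) (m : Fin r → ℤ) (ξ : ℂ) :
    (ν.prod ν).real A - r * ∑ i, (m i : ℝ) ^ 2 * defect ν (v i * ξ) ≤
      ∫ p in A, Real.cos (2 * Real.pi * ((∑ i, (m i : ℂ) * v i) * (p.1 - p.2) * ξ).re)
        ∂(ν.prod ν) := by
  have h1 : ∫ p in A, (1 - Real.cos (2 * Real.pi * ((∑ i, (m i : ℂ) * v i) * (p.1 - p.2) * ξ).re))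
        ∂(ν.prod ν) ≤ r * ∑ i, (m i : ℝ) ^ 2 * defect ν (v i * ξ) := by
    calc _ ≤ ∫ p, (1 - Real.cos (2 * Real.pi * ((∑ i, (m i : ℂ) * v i) * (p.1 - p.2) * ξ).re))
          ∂(ν.prod ν) :=
        setIntegral_le_integral (integrable_one_sub_cos _ (by fun_prop))
          (Eventually.of_forall fun p => by simpa using Real.cos_le_one _)
      _ ≤ ∫ p, ((r : ℝ) * ∑ i, (m i : ℝ) ^ 2 *
          (1 - Real.cos (2 * Real.pi * (v i * ξ * (p.1 - p.2)).re))) ∂(ν.prod ν) := by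
        refine integral_mono (integrable_one_sub_cos _ (by fun_prop)) ?_ fun p => ?_
        · exact (integrable_finsetSum _ fun i _ =>
            (integrable_one_sub_cos _ (by fun_prop)).const_mul _).const_mul _
        · refine le_trans (le_of_eq ?_)
            (one_sub_cos_sum_le m fun i => 2 * Real.pi * (v i * ξ * (p.1 - p.2)).re)
          simp only
          congr 2
          rw [Finset.sum_mul, Finset.sum_mul, Complex.re_sum, Finset.mul_sum]
          refine Finset.sum_congr rfl fun i _ => ?_
          rw [show (m i : ℂ) * v i * (p.1 - p.2) * ξ = ((m i : ℝ) : ℂ) * (v i * ξ * (p.1 - p.2)) by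
            push_cast; ring, Complex.re_ofReal_mul]
          ring
      _ = _ := by
        rw [integral_const_mul, integral_finsetSum _ fun i _ =>
            (integrable_one_sub_cos _ (by fun_prop)).const_mul _]
        simp only [integral_const_mul]
        rfl
  rw [integral_sub (integrable_const _) (integrable_cos _ (by fun_prop))] at h1
  simp only [integral_const, smul_eq_mul, mul_one, measureReal_restrict_apply_univ] at h1
  linarith


lemma finite_GAPset {r : ℕ} (v : Fin r → ℂ) (L : Fin r → ℝ) : (GAPset v L).Finite := by
  have h : (GAPset v L) ⊆ (fun m : Fin r → ℤ => ∑ i, (m i : ℂ) * v i) ''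
      (Fintype.piFinset fun i => Finset.Icc (-⌊L i⌋) ⌊L i⌋ : Finset (Fin r → ℤ)) := by
    rintro z ⟨m, hm, rfl⟩
    refine ⟨m, ?_, rfl⟩
    simp only [Finset.mem_coe, Fintype.mem_piFinset, Finset.mem_Icc]
    intro i
    have := abs_le.1 (hm i)
    exact ⟨neg_le.1 (Int.le_floor.2 (by push_cast; linarith)), Int.le_floor.2 this.2⟩
  exact (Finset.finite_toSet _).image _ |>.subset h

lemma zero_mem_GAPset {r : ℕ} (v : Fin r → ℂ) {L : Fin r → ℝ} (hL : ∀ i, 0 ≤ L i) :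
    0 ∈ GAPset v L := ⟨0, by simpa using hL, by simp⟩

lemma card_Icc_floor_le {T : ℝ} (hT : 0 ≤ T) :
    ((Finset.Icc ⌊-T⌋ ⌊T⌋).card : ℝ) ≤ 2 * T + 2 := by
  rw [Int.card_Icc]
  have h1 := Int.floor_le T
  have h2 := Int.lt_floor_add_one (-T)
  have h3 : ⌊-T⌋ ≤ ⌊T⌋ := Int.floor_le_floor (by linarith)
  rw [← Int.cast_natCast, Int.toNat_of_nonneg (by omega)]
  push_cast
  linarith

/-- A progression is covered by few translates of its contraction. -/
lemma ncard_GAPset_le {r : ℕ} (v : Fin r → ℂ) {L : Fin r → ℝ} (hL : ∀ i, 0 < L i) {T : ℝ}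
    (hT : 0 < T) :
    ((GAPset v L).ncard : ℝ) ≤ (2 * T + 2) ^ r * (GAPset v fun i => L i / T).ncard := by
  classical
  have hQ := finite_GAPset v L
  have hQ' := finite_GAPset v fun i => L i / T
  have hch : ∀ z : ℂ, ∃ m : Fin r → ℤ, z ∈ GAPset v L →
      (∀ i, |(m i : ℝ)| ≤ L i) ∧ z = ∑ i, (m i : ℂ) * v i := fun z => by
    by_cases hz : z ∈ GAPset v L
    · obtain ⟨m, hm⟩ := hz
      exact ⟨m, fun _ => hm⟩
    · exact ⟨0, fun h => absurd h hz⟩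
  choose m hm using hch
  let f : ℂ → Fin r → ℤ := fun z i => ⌊m z i * T / L i⌋
  have key := Finset.card_le_mul_card_image_of_maps_to (f := f) (s := hQ.toFinset)
    (t := Fintype.piFinset fun _ : Fin r => Finset.Icc ⌊-T⌋ ⌊T⌋) ?_ hQ'.toFinset.card ?_
  · rw [Set.ncard_eq_toFinset_card _ hQ, Set.ncard_eq_toFinset_card _ hQ']
    have : ((Fintype.piFinset fun _ : Fin r => Finset.Icc ⌊-T⌋ ⌊T⌋).card : ℝ) ≤ (2 * T + 2) ^ r := by
      rw [Fintype.card_piFinset_const]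
      push_cast
      gcongr
      exact card_Icc_floor_le hT.le
    calc (hQ.toFinset.card : ℝ) ≤ hQ'.toFinset.card *
          (Fintype.piFinset fun _ : Fin r => Finset.Icc ⌊-T⌋ ⌊T⌋).card := by exact_mod_cast key
      _ ≤ hQ'.toFinset.card * (2 * T + 2) ^ r := by gcongr
      _ = _ := mul_comm _ _
  · intro z hz
    rw [Fintype.mem_piFinset]
    intro i
    have h1 := abs_le.1 ((hm z (hQ.mem_toFinset.1 hz)).1 i)
    have hLi := hL i
    rw [Finset.mem_Icc]
    constructor
    · apply Int.floor_le_floor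
      rw [le_div_iff₀ hLi]
      nlinarith
    · apply Int.floor_le_floor
      rw [div_le_iff₀ hLi]
      nlinarith
  · intro b _
    rcases Finset.eq_empty_or_nonempty {a ∈ hQ.toFinset | f a = b} with he | ⟨z₀, hz₀⟩
    · simp [he]
    rw [Finset.mem_filter, hQ.mem_toFinset] at hz₀
    refine Finset.card_le_card_of_injOn (fun z => z - z₀) ?_ (fun _ _ _ _ h => sub_left_injective h)
    intro z hz
    rw [Finset.mem_coe, Finset.mem_filter, hQ.mem_toFinset] at hz
    rw [Finset.mem_coe, hQ'.mem_toFinset]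
    refine ⟨fun i => m z i - m z₀ i, fun i => ?_, ?_⟩
    · have h1 := Int.abs_sub_lt_one_of_floor_eq_floor (congrFun (hz.2.trans hz₀.2.symm) i)
      have hLi := hL i
      rw [← sub_div, ← sub_mul, abs_div, abs_mul, abs_of_pos hT, abs_of_pos hLi,
        div_lt_one hLi] at h1
      push_cast
      rw [le_div_iff₀ hT]
      exact h1.le
    · simp only
      rw [(hm z hz.1).2, (hm z₀ hz₀.1).2, ← Finset.sum_sub_distrib]
      refine Finset.sum_congr rfl fun i _ => ?_
      rw [← (hm z hz.1).2, ← (hm z₀ hz₀.1).2]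
      push_cast
      ring

lemma sub_mem_GAPset {r : ℕ} {v : Fin r → ℂ} {L L' : Fin r → ℝ} (hL : ∀ i, L' i + L' i ≤ L i)
    {z w : ℂ} (hz : z ∈ GAPset v L') (hw : w ∈ GAPset v L') : z - w ∈ GAPset v L := by
  obtain ⟨m, hm, rfl⟩ := hz
  obtain ⟨n, hn, rfl⟩ := hw
  refine ⟨fun i => m i - n i, fun i => ?_, ?_⟩
  · push_cast
    exact (abs_sub _ _).trans ((add_le_add (hm i) (hn i)).trans (hL i))
  · rw [← Finset.sum_sub_distrib]
    refine Finset.sum_congr rfl fun i _ => ?_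
    push_cast
    ring

/-- A ball is covered by few sets of diameter at most one. -/
lemma card_filter_norm_sub_le (S : Finset ℂ) {U : Set ℂ} (hU : U.Finite)
    (hSU : ∀ z ∈ S, ∀ w ∈ S, z - w ∈ U) {R : ℝ} (hR : 0 ≤ R) (q : ℂ) :
    (({q' ∈ S | ‖q - q'‖ ≤ R} : Finset ℂ).card : ℝ) ≤
      (4 * R + 2) ^ 2 * (U ∩ Metric.closedBall 0 1).ncard := by
  classical
  have hV : (U ∩ Metric.closedBall 0 1).Finite := hU.subset Set.inter_subset_left
  let f : ℂ → ℤ × ℤ := fun z => (⌊2 * (z - q).re⌋, ⌊2 * (z - q).im⌋)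
  have key := Finset.card_le_mul_card_image_of_maps_to (f := f)
    (s := {q' ∈ S | ‖q - q'‖ ≤ R})
    (t := Finset.Icc ⌊-(2 * R)⌋ ⌊2 * R⌋ ×ˢ Finset.Icc ⌊-(2 * R)⌋ ⌊2 * R⌋) ?_ hV.toFinset.card ?_
  · rw [Set.ncard_eq_toFinset_card _ hV]
    rw [Finset.card_product] at key
    have h1 := card_Icc_floor_le (T := 2 * R) (by linarith)
    set N := (Finset.Icc ⌊-(2 * R)⌋ ⌊2 * R⌋).card
    calc _ ≤ (hV.toFinset.card : ℝ) * (N * N) := by exact_mod_cast key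
      _ ≤ hV.toFinset.card * ((4 * R + 2) * (4 * R + 2)) := by gcongr <;> linarith
      _ = _ := by ring
  · intro z hz
    have h1 := (Finset.mem_filter.1 hz).2
    rw [norm_sub_rev] at h1
    have h2 := abs_le.1 ((Complex.abs_re_le_norm _).trans h1)
    have h3 := abs_le.1 ((Complex.abs_im_le_norm _).trans h1)
    simp only [f, Finset.mem_product, Finset.mem_Icc]
    refine ⟨⟨?_, ?_⟩, ?_, ?_⟩ <;> apply Int.floor_le_floor <;> linarith
  · intro b _
    rcases Finset.eq_empty_or_nonempty {a ∈ ({q' ∈ S | ‖q - q'‖ ≤ R} : Finset ℂ) | f a = b} with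
      he | ⟨z₀, hz₀⟩
    · simp [he]
    rw [Finset.mem_filter, Finset.mem_filter] at hz₀
    refine Finset.card_le_card_of_injOn (fun z => z - z₀) ?_ (fun _ _ _ _ h => sub_left_injective h)
    intro z hz
    rw [Finset.mem_coe, Finset.mem_filter, Finset.mem_filter] at hz
    rw [Finset.mem_coe, hV.mem_toFinset]
    refine ⟨hSU z hz.1.1 z₀ hz₀.1.1, ?_⟩
    have h1 := hz.2.trans hz₀.2.symm
    have h2 := Int.abs_sub_lt_one_of_floor_eq_floor (congrArg Prod.fst h1)
    have h3 := Int.abs_sub_lt_one_of_floor_eq_floor (congrArg Prod.snd h1)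
    rw [mem_closedBall_zero_iff, ← sq_le_one_iff₀ (norm_nonneg _), Complex.sq_norm,
      Complex.normSq_apply]
    simp only [Complex.sub_re, Complex.sub_im] at *
    rw [abs_lt] at h2 h3
    nlinarith

lemma sum_exp_le (S : Finset ℂ) {U : Set ℂ} (hU : U.Finite)
    (hSU : ∀ z ∈ S, ∀ w ∈ S, z - w ∈ U) {R a : ℝ} (hR : 0 ≤ R) (ha : 0 ≤ a) :
    ∑ q ∈ S, ∑ q' ∈ S, Real.exp (-(a * ‖q - q'‖ ^ 2)) ≤
      (S.card : ℝ) ^ 2 * Real.exp (-(a * R ^ 2)) +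
        S.card * ((4 * R + 2) ^ 2 * (U ∩ Metric.closedBall 0 1).ncard) := by
  have h : ∀ q ∈ S, ∑ q' ∈ S, Real.exp (-(a * ‖q - q'‖ ^ 2)) ≤
      S.card * Real.exp (-(a * R ^ 2)) + (4 * R + 2) ^ 2 * (U ∩ Metric.closedBall 0 1).ncard := by
    intro q _
    have hcard := card_filter_norm_sub_le S hU hSU hR q
    refine le_trans ?_ (add_le_add_right hcard _)
    calc _ ≤ ∑ q' ∈ S, (Real.exp (-(a * R ^ 2)) + if ‖q - q'‖ ≤ R then 1 else 0) := by
          refine Finset.sum_le_sum fun q' _ => ?_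
          split_ifs with hq
          · have := Real.exp_pos (-(a * R ^ 2))
            have h2 : Real.exp (-(a * ‖q - q'‖ ^ 2)) ≤ 1 := by
              rw [Real.exp_le_one_iff]; nlinarith [sq_nonneg ‖q - q'‖]
            linarith
          · rw [add_zero]
            push Not at hq
            gcongr
      _ = _ := by
        rw [Finset.sum_add_distrib, Finset.sum_boole]
        simp
  refine (Finset.sum_le_sum h).trans (le_of_eq ?_)
  simp only [Finset.sum_const, nsmul_eq_mul]
  ring

/-- The concentration probability is at most the reciprocal of the dispersion, up to errors that
depend on the contraction factor `T`, the radius `R` and the cutoff `s`. -/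
lemma concProb_le_of_contraction (ν : Measure ℂ) [IsProbabilityMeasure ν] {c p : ℝ} (hc : 0 ≤ c)
    (hp0 : 0 < p) (hp : p ≤ (ν.prod ν).real {x | c ≤ ‖x.1 - x.2‖}) {μ : ℝ} (h0 : 0 < μ)
    (h1 : μ ≤ 1) {r : ℕ} (v : Fin r → ℂ) (k : Fin r → ℕ) (hk : ∀ i, 1 ≤ k i) {s R T : ℝ}
    (hR : 0 ≤ R) (hT : 2 ≤ T) (hTs : 16 * r * s / p ≤ T ^ 2) :
    concProb ν μ (fun x : Σ i : Fin r, Fin (k i) => v x.1) ≤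
      Real.exp (-s) + 2 / p * (Real.exp (-(Real.pi * c ^ 2 * R ^ 2)) +
        (4 * R + 2) ^ 2 * (2 * T + 2) ^ r /
          dispersion (GAPset v fun i => Real.sqrt (μ * k i))) := by
  set L : Fin r → ℝ := fun i => Real.sqrt (μ * k i) with hL
  have hμk : ∀ i, 0 < μ * k i := fun i => mul_pos h0 (by exact_mod_cast hk i)
  have hL0 : ∀ i, 0 < L i := fun i => Real.sqrt_pos.2 (hμk i)
  have hL2 : ∀ i, L i ^ 2 = μ * k i := fun i => Real.sq_sqrt (hμk i).le
  have hT0 : 0 < T := by linarith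
  set L' : Fin r → ℝ := fun i => L i / T with hL'
  have hS := finite_GAPset v L'
  have hU := finite_GAPset v L
  set S := hS.toFinset with hSdef
  set A : Set (ℂ × ℂ) := {x | c ≤ ‖x.1 - x.2‖} with hA
  have hAm : MeasurableSet A := measurableSet_le (by fun_prop) (by fun_prop)
  set ρ := (ν.prod ν).restrict A with hρ
  have hSne : S.Nonempty :=
    ⟨0, hS.mem_toFinset.2 (zero_mem_GAPset v fun i => (div_pos (hL0 i) hT0).le)⟩
  have hScard : (0 : ℝ) < S.card := by exact_mod_cast hSne.card_pos
  have hSU : ∀ z ∈ S, ∀ w ∈ S, z - w ∈ GAPset v L := fun z hz w hw =>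
    sub_mem_GAPset (fun i => by
      simp only [hL']
      rw [← add_div, div_le_iff₀ hT0]
      nlinarith [hL0 i]) (hS.mem_toFinset.1 hz) (hS.mem_toFinset.1 hw)
  set b : ℝ := 2 / (p * (S.card : ℝ) ^ 2) with hb
  have hb0 : 0 ≤ b := by positivity
  have hlow : ∀ ξ, (∑ i, L i ^ 2 * defect ν (v i * ξ)) ≤ 2 * s → 1 ≤ b * kernel ρ S ξ := by
    intro ξ hG
    have hterm : ∀ q ∈ S, ∀ q' ∈ S, p / 2 ≤
        ∫ x : ℂ × ℂ, Real.cos (2 * Real.pi * ((q - q') * (x.1 - x.2) * ξ).re) ∂ρ := by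
      intro q hq q' hq'
      obtain ⟨m, hm, hmq⟩ := sub_mem_GAPset (L := fun i => L' i + L' i) (fun i => le_rfl)
        (hS.mem_toFinset.1 hq) (hS.mem_toFinset.1 hq')
      rw [hmq]
      refine le_trans ?_ (le_integral_cos ν A v m ξ)
      have h2 : ∑ i, (m i : ℝ) ^ 2 * defect ν (v i * ξ) ≤
          4 / T ^ 2 * ∑ i, L i ^ 2 * defect ν (v i * ξ) := by
        rw [Finset.mul_sum]
        refine Finset.sum_le_sum fun i _ => ?_
        rw [← mul_assoc]
        refine mul_le_mul_of_nonneg_right ?_ (defect_nonneg _ _)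
        have h3 : |(m i : ℝ)| ^ 2 ≤ (L' i + L' i) ^ 2 := by gcongr; exact hm i
        rw [sq_abs] at h3
        refine h3.trans (le_of_eq ?_)
        simp only [hL']
        field_simp
        ring
      have h4 : r * ∑ i, (m i : ℝ) ^ 2 * defect ν (v i * ξ) ≤ p / 2 := by
        calc _ ≤ r * (4 / T ^ 2 * (2 * s)) := by gcongr; exact h2.trans (by gcongr)
          _ ≤ p / 2 := by
            rw [div_le_iff₀ hp0] at hTs
            rw [div_mul_eq_mul_div, mul_div_assoc', div_le_iff₀ (by positivity)]
            linarith
      linarith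
    have h5 : (S.card : ℝ) ^ 2 * (p / 2) ≤ kernel ρ S ξ := by
      calc (S.card : ℝ) ^ 2 * (p / 2) = ∑ q ∈ S, ∑ q' ∈ S, p / 2 := by
            simp only [Finset.sum_const, nsmul_eq_mul]; ring
        _ ≤ _ := Finset.sum_le_sum fun q hq => Finset.sum_le_sum fun q' hq' => hterm q hq q' hq'
    calc (1 : ℝ) = b * ((S.card : ℝ) ^ 2 * (p / 2)) := by rw [hb]; field_simp
      _ ≤ _ := by gcongr
  have hmain := concProb_le ν h0 h1 (fun x : Σ i : Fin r, Fin (k i) => v x.1)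
    (fun ξ => Real.exp (-s) + b * kernel ρ S ξ) (fun ξ => by
      have hsum : ∑ x : Σ i : Fin r, Fin (k i), μ * defect ν (v x.1 * ξ) =
          ∑ i, L i ^ 2 * defect ν (v i * ξ) := by
        rw [Fintype.sum_sigma]
        refine Finset.sum_congr rfl fun i _ => ?_
        simp only [Finset.sum_const, Finset.card_univ, Fintype.card_fin, nsmul_eq_mul, hL2]
        ring
      rw [hsum]
      have hG0 : 0 ≤ ∑ i, L i ^ 2 * defect ν (v i * ξ) :=
        Finset.sum_nonneg fun i _ => mul_nonneg (sq_nonneg _) (defect_nonneg _ _)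
      rcases le_total (∑ i, L i ^ 2 * defect ν (v i * ξ)) (2 * s) with hG | hG
      · have h2 : Real.exp (-(1 / 2 * ∑ i, L i ^ 2 * defect ν (v i * ξ))) ≤ 1 := by
          rw [Real.exp_le_one_iff]; linarith
        linarith [hlow ξ hG, Real.exp_pos (-s)]
      · have h2 : Real.exp (-(1 / 2 * ∑ i, L i ^ 2 * defect ν (v i * ξ))) ≤ Real.exp (-s) := by
          rw [Real.exp_le_exp]; linarith
        linarith [mul_nonneg hb0 (kernel_nonneg ρ S ξ)])
    (by
      simp only [add_mul, mul_assoc]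
      exact (integrable_gaussian.const_mul _).add ((integrable_kernel ρ S).const_mul b))
  refine hmain.trans ?_
  simp only [add_mul, mul_assoc]
  rw [integral_add (integrable_gaussian.const_mul _) ((integrable_kernel ρ S).const_mul b),
    integral_const_mul, integral_const_mul, integral_gaussian_one, mul_one]
  refine add_le_add_right ?_ _
  have hρ1 : ρ.real Set.univ ≤ 1 := by
    rw [hρ, measureReal_restrict_apply_univ]; exact measureReal_le_one
  have hint := (integral_kernel_le ρ hρ1 hc (ae_restrict_mem hAm) S).trans
    (sum_exp_le S hU hSU hR (by positivity))
  set V : ℝ := ((GAPset v L ∩ Metric.closedBall 0 1).ncard : ℝ) with hV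
  have hdisp : V / S.card ≤ (2 * T + 2) ^ r / dispersion (GAPset v L) := by
    have h2 := ncard_GAPset_le v hL0 hT0
    rw [Set.ncard_eq_toFinset_card _ hS] at h2
    have h3 : (0 : ℝ) < (GAPset v L).ncard := by
      exact_mod_cast (Set.ncard_pos hU).2 ⟨0, zero_mem_GAPset v fun i => (hL0 i).le⟩
    rw [dispersion, div_div_eq_mul_div, div_le_div_iff₀ hScard h3]
    have : 0 ≤ V := Nat.cast_nonneg _
    calc V * (GAPset v L).ncard ≤ V * ((2 * T + 2) ^ r * S.card) := by gcongr
      _ = _ := by ring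
  calc _ ≤ b * ((S.card : ℝ) ^ 2 * Real.exp (-(Real.pi * c ^ 2 * R ^ 2)) +
        S.card * ((4 * R + 2) ^ 2 * V)) := by gcongr
    _ = 2 / p * (Real.exp (-(Real.pi * c ^ 2 * R ^ 2)) + (4 * R + 2) ^ 2 * (V / S.card)) := by
      rw [hb]; field_simp
    _ ≤ 2 / p * (Real.exp (-(Real.pi * c ^ 2 * R ^ 2)) + (4 * R + 2) ^ 2 *
        ((2 * T + 2) ^ r / dispersion (GAPset v L))) := by gcongr
    _ = _ := by rw [← mul_div_assoc, mul_assoc]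

lemma one_le_dispersion {r : ℕ} (v : Fin r → ℂ) {L : Fin r → ℝ} (hL : ∀ i, 0 ≤ L i) :
    1 ≤ dispersion (GAPset v L) := by
  have hU := finite_GAPset v L
  have hV : (GAPset v L ∩ Metric.closedBall 0 1).Finite := hU.subset Set.inter_subset_left
  have hpos : 0 < (GAPset v L ∩ Metric.closedBall 0 1).ncard :=
    (Set.ncard_pos hV).2 ⟨0, zero_mem_GAPset v hL, by simp⟩
  rw [dispersion, one_le_div (by exact_mod_cast hpos)]
  exact_mod_cast Set.ncard_le_ncard Set.inter_subset_left hU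

/-- Powers of `1 + log D` are absorbed by arbitrarily small powers of `D`. -/
lemma one_add_log_pow_le {ε : ℝ} (hε : 0 < ε) {n : ℕ} (hn : 0 < n) {D : ℝ} (hD : 1 ≤ D) :
    (1 + Real.log D) ^ n ≤ (1 + n / ε) ^ n * D ^ ε := by
  have hn' : (0 : ℝ) < n := by exact_mod_cast hn
  have h1 : 1 + Real.log D ≤ (1 + n / ε) * D ^ (ε / n) := by
    have h2 := Real.log_le_rpow_div (by linarith : 0 ≤ D) (div_pos hε hn')
    have h3 : 1 ≤ D ^ (ε / n) := Real.one_le_rpow hD (by positivity)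
    rw [div_div_eq_mul_div, mul_comm, mul_div_right_comm] at h2
    linarith
  have h4 := Real.log_nonneg hD
  calc _ ≤ ((1 + n / ε) * D ^ (ε / n)) ^ n := by gcongr
    _ = _ := by
      rw [mul_pow, ← Real.rpow_natCast (D ^ (ε / n)), ← Real.rpow_mul (by linarith),
        div_mul_cancel₀ _ hn'.ne']

end LittlewoodOfford

open LittlewoodOfford
/-- **Forward Littlewood–Offord theorem** (Theorem 6.6). -/
theorem forward_littlewood_offord
    (κ : ℝ) (hκ : 1 ≤ κ) (r : ℕ) (hr : 1 ≤ r) (ε : ℝ) (hε : 0 < ε) :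
    ∃ C : ℝ, 0 < C ∧
      ∀ (Ω : Type) [MeasureSpace Ω], IsProbabilityMeasure (ℙ : Measure Ω) →
      ∀ α : Ω → ℂ, Measurable α → HasControlledSecondMoment α κ →
      ∀ μ : ℝ, 0 < μ → μ ≤ 1 →
      ∀ (v : Fin r → ℂ) (k : Fin r → ℕ), (∀ i, 1 ≤ k i) →
        concProb (Measure.map α ℙ) μ (fun p : Σ i : Fin r, Fin (k i) => v p.1)
          ≤ C * dispersion (GAPset v fun i => Real.sqrt (μ * k i)) ^ (-1 + ε) := by
  have hκ0 : 0 < κ := by linarith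
  set c : ℝ := Real.sqrt (1 / (2 * κ ^ 4)) with hcdef
  have hc2 : c ^ 2 = 1 / (2 * κ ^ 4) := Real.sq_sqrt (by positivity)
  have hc : 0 < c := Real.sqrt_pos.2 (by positivity)
  set p : ℝ := 1 / (8 * κ ^ 6) with hpdef
  have hp0 : 0 < p := by positivity
  set K : ℝ := 1 / c with hK
  have hK0 : 0 < K := by positivity
  set M : ℝ := 16 * r / p + 2 with hM
  have hM2 : 2 ≤ M := le_add_of_nonneg_left (by positivity)
  set C₀ : ℝ := 1 + 2 / p * (1 + (4 * K + 2) ^ 2 * (2 * M + 2) ^ r) with hC₀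
  have hC₀p : 0 < C₀ := by positivity
  refine ⟨C₀ * (1 + (r + 2 : ℕ) / ε) ^ (r + 2), by positivity, ?_⟩
  intro Ω _ hΩ α hα hctrl μ h0 h1 v k hk
  have : IsProbabilityMeasure (Measure.map α ℙ) := Measure.isProbabilityMeasure_map hα.aemeasurable
  set D := dispersion (GAPset v fun i => Real.sqrt (μ * k i)) with hD
  have hD1 : 1 ≤ D := one_le_dispersion v fun i => Real.sqrt_nonneg _
  have hD0 : 0 < D := by linarith
  set s := 1 + Real.log D with hs
  have hlog := Real.log_nonneg hD1
  have hs1 : 1 ≤ s := by linarith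
  have hss : s ≤ s ^ 2 := by nlinarith
  have hprob := prob_diff_ge (Measure.map α ℙ) hκ (controlled_map hα hctrl) hc2
  have hexp : Real.exp (-s) ≤ 1 / D := by
    rw [one_div, ← Real.exp_log (inv_pos.2 hD0), Real.log_inv, Real.exp_le_exp]
    linarith
  have hmain := concProb_le_of_contraction (Measure.map α ℙ) hc.le hp0 hprob h0 h1 v k hk
    (s := s) (R := K * s) (T := M * s) (by positivity) (by nlinarith) (by
      have h2 : 16 * r * s / p ≤ M * s := by
        rw [mul_div_right_comm]; gcongr; linarith
      have h4 : 2 ≤ M * s := by nlinarith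
      nlinarith)
  have hexp2 : Real.exp (-(Real.pi * c ^ 2 * (K * s) ^ 2)) ≤ 1 / D := by
    refine le_trans ?_ hexp
    rw [Real.exp_le_exp, neg_le_neg_iff]
    have h2 : Real.pi * c ^ 2 * (K * s) ^ 2 = Real.pi * s ^ 2 := by rw [hK]; field_simp
    rw [h2]
    nlinarith [Real.pi_gt_three]
  have hpow : s ≤ s ^ (r + 2) := le_self_pow₀ hs1 (by omega)
  have hone : 1 ≤ s ^ (r + 2) := hs1.trans hpow
  have hM0 : 0 ≤ M := by linarith
  rw [← hD] at hmain
  clear_value D s C₀ K M p c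
  have h3 : (4 * (K * s) + 2) ^ 2 * (2 * (M * s) + 2) ^ r ≤
      (4 * K + 2) ^ 2 * (2 * M + 2) ^ r * s ^ (r + 2) := by
    have h4 : 4 * (K * s) + 2 ≤ (4 * K + 2) * s := by linarith
    have h5 : 2 * (M * s) + 2 ≤ (2 * M + 2) * s := by linarith
    calc _ ≤ ((4 * K + 2) * s) ^ 2 * ((2 * M + 2) * s) ^ r := by gcongr
      _ = _ := by rw [mul_pow, mul_pow, pow_add]; ring
  calc _ ≤ _ := hmain
    _ ≤ s ^ (r + 2) / D + 2 / p * (s ^ (r + 2) / D +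
        (4 * K + 2) ^ 2 * (2 * M + 2) ^ r * s ^ (r + 2) / D) := by
      have h4 : 1 / D ≤ s ^ (r + 2) / D := div_le_div_of_nonneg_right hone hD0.le
      exact add_le_add (hexp.trans h4) (mul_le_mul_of_nonneg_left
        (add_le_add (hexp2.trans h4) (div_le_div_of_nonneg_right h3 hD0.le)) (by positivity))
    _ = C₀ * (s ^ (r + 2) / D) := by rw [hC₀]; ring
    _ ≤ C₀ * ((1 + (r + 2 : ℕ) / ε) ^ (r + 2) * D ^ ε / D) := by
      gcongr
      rw [hs]
      exact one_add_log_pow_le (n := r + 2) hε (by omega) hD1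
    _ = _ := by
      rw [neg_add_eq_sub, Real.rpow_sub_one hD0.ne']
      ring
end

section
/- For every integer r ≥ 1 there is a constant C_r such that the following holds. Let K ≥ 1, let Q ⊂ ℂ be a symmetric GAP of rank r, and let R ≥ 0. Then there exist an integer d ≥ 0, elements w₁,…,w_d ∈ Q and w'₁,…,w'_d ∈ Q such that: (i) |w_i| ≥ K·|w_{i+1}| for all 1 ≤ i ≤ d−1; (ii) |w_i| > R and |w'_i| ≤ |w_i| for all 1 ≤ i ≤ d; (iii) #Q ≤ (∏_{i=1}^{d} C_r·K·K_i) · #(Q ∩ B(0,R)), where K_i := 1 + K·|Im(w'_i/w_i)|; (iv) d ≤ C_r·(1 + log(#Q / #(Q ∩ B(0,R))) / log(max(K,2))). -/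
open MeasureTheory ProbabilityTheory Filter

/-- Pigeonhole: if differences of elements of equal colour lie in `E`, then `S` has at most
`(number of colours) * #E` elements. -/
lemma card_le_card_mul_ncard_of_coloring {G γ : Type*} [AddGroup G] (S : Finset G) {E : Set G}
    (hE : E.Finite) (c : G → γ) (T : Finset γ) (hT : ∀ z ∈ S, c z ∈ T)
    (hdiff : ∀ x ∈ S, ∀ y ∈ S, c x = c y → x - y ∈ E) :
    S.card ≤ T.card * E.ncard := by
  classical
  rw [mul_comm]
  refine Finset.card_le_mul_card_image_of_maps_to hT _ fun b _ => ?_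
  rcases (S.filter fun z => c z = b).eq_empty_or_nonempty with h | ⟨y, hy⟩
  · simp [h]
  · rw [← Set.ncard_coe_finset]
    rw [Finset.mem_filter] at hy
    refine Set.ncard_le_ncard_of_injOn (fun x => x - y) (fun x hx => ?_)
      (fun x _ x' _ h => sub_left_injective h) hE
    rw [Finset.mem_coe, Finset.mem_filter] at hx
    exact hdiff x hx.1 y hy.1 (hx.2.trans hy.2.symm)

lemma finite_GAPset {r : ℕ} (v : Fin r → ℂ) (L : Fin r → ℝ) : (GAPset v L).Finite := by
  refine ((Set.Finite.pi' fun i : Fin r => Set.finite_Icc (-⌊L i⌋) ⌊L i⌋).image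
    fun m : Fin r → ℤ => ∑ i, (m i : ℂ) * v i).subset ?_
  rintro z ⟨m, hm, rfl⟩
  refine ⟨m, fun i => ?_, rfl⟩
  obtain ⟨h₁, h₂⟩ := abs_le.1 (hm i)
  refine ⟨?_, Int.le_floor.2 h₂⟩
  have : -m i ≤ ⌊L i⌋ := Int.le_floor.2 (by push_cast; linarith)
  linarith

lemma zero_mem_GAPset {r : ℕ} (v : Fin r → ℂ) {L : Fin r → ℝ} (hL : ∀ i, 0 < L i) :
    (0 : ℂ) ∈ GAPset v L :=
  ⟨0, fun i => by simpa using (hL i).le, by simp⟩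

lemma add_mem_GAPset {r : ℕ} {v : Fin r → ℂ} {L L' : Fin r → ℝ} {x y : ℂ}
    (hx : x ∈ GAPset v L) (hy : y ∈ GAPset v L') : x + y ∈ GAPset v (L + L') := by
  obtain ⟨m, hm, rfl⟩ := hx
  obtain ⟨n, hn, rfl⟩ := hy
  refine ⟨m + n, fun i => ?_, ?_⟩
  · have := abs_add_le (m i : ℝ) (n i)
    have := hm i
    have := hn i
    simp only [Pi.add_apply, Int.cast_add]
    linarith
  · simp [add_mul, Finset.sum_add_distrib]

lemma natCast_mul_mem_GAPset {r : ℕ} {v : Fin r → ℂ} {L : Fin r → ℝ} {x : ℂ}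
    (hx : x ∈ GAPset v L) (a : ℕ) : (a : ℂ) * x ∈ GAPset v ((a : ℝ) • L) := by
  obtain ⟨m, hm, rfl⟩ := hx
  refine ⟨fun i => a * m i, fun i => ?_, ?_⟩
  · have := mul_le_mul_of_nonneg_left (hm i) (Nat.cast_nonneg (α := ℝ) a)
    simpa [abs_mul] using this
  · simp [Finset.mul_sum, mul_assoc]

lemma GAPset_mono {r : ℕ} (v : Fin r → ℂ) {L L' : Fin r → ℝ} (h : L ≤ L') :
    GAPset v L ⊆ GAPset v L' := by
  rintro z ⟨m, hm, rfl⟩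
  exact ⟨m, fun i => (hm i).trans (h i), rfl⟩

/-- A `T`-fold dilate of a GAP is covered by `(2 * T + 1) ^ r` cells whose differences lie in
the GAP. -/
lemma exists_coloring_GAPset {r : ℕ} (v : Fin r → ℂ) {L : Fin r → ℝ} (hL : ∀ i, 0 < L i)
    (T : ℕ) :
    ∃ c : ℂ → Fin r → ℤ,
      (∀ z ∈ GAPset v ((T : ℝ) • L),
        c z ∈ Fintype.piFinset fun _ : Fin r => Finset.Icc (-(T : ℤ)) T) ∧
      ∀ x ∈ GAPset v ((T : ℝ) • L), ∀ y ∈ GAPset v ((T : ℝ) • L),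
        c x = c y → x - y ∈ GAPset v L := by
  have H : ∀ z : ℂ, ∃ m : Fin r → ℤ, z ∈ GAPset v ((T : ℝ) • L) →
      (∀ i, |(m i : ℝ)| ≤ T * L i) ∧ z = ∑ i, (m i : ℂ) * v i := by
    intro z
    by_cases hz : z ∈ GAPset v ((T : ℝ) • L)
    · obtain ⟨m, hm, h⟩ := hz
      exact ⟨m, fun _ => ⟨hm, h⟩⟩
    · exact ⟨0, fun h => absurd h hz⟩
  choose m hm using H
  refine ⟨fun z i => ⌊(m z i : ℝ) / L i⌋, fun z hz => ?_, fun x hx y hy hxy => ?_⟩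
  · rw [Fintype.mem_piFinset]
    intro i
    obtain ⟨h₁, h₂⟩ := abs_le.1 ((hm z hz).1 i)
    rw [Finset.mem_Icc]
    constructor
    · rw [Int.le_floor, le_div_iff₀ (hL i)]
      push_cast
      linarith
    · have : (m z i : ℝ) / L i ≤ T := by rwa [div_le_iff₀ (hL i)]
      exact_mod_cast (Int.floor_le _).trans this
  · refine ⟨m x - m y, fun i => ?_, ?_⟩
    · have h := (Int.abs_sub_lt_one_of_floor_eq_floor (congrFun hxy i)).le
      rw [← sub_div, abs_div, abs_of_pos (hL i), div_le_one (hL i)] at h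
      simpa using h
    · conv_lhs => rw [(hm x hx).2, (hm y hy).2]
      simp [sub_mul, Finset.sum_sub_distrib]

lemma ncard_GAPset_ball_le_of_card {r : ℕ} (v : Fin r → ℂ) {L : Fin r → ℝ}
    (hL : ∀ i, 0 < L i) (T : ℕ) (S : Finset ℂ) (hS : ∀ z ∈ S, z ∈ GAPset v ((T : ℝ) • L))
    {γ : Type*} (c : ℂ → γ) (P : Finset γ) (hP : ∀ z ∈ S, c z ∈ P) {ρ : ℝ}
    (hdiff : ∀ x ∈ S, ∀ y ∈ S, c x = c y → ‖x - y‖ ≤ ρ) :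
    S.card ≤ (2 * T + 1) ^ r * P.card * (GAPset v L ∩ Metric.closedBall 0 ρ).ncard := by
  obtain ⟨b, hb, hb'⟩ := exists_coloring_GAPset v hL T
  have := card_le_card_mul_ncard_of_coloring S
    ((finite_GAPset v L).inter_of_left (Metric.closedBall 0 ρ)) (fun z => (b z, c z))
    ((Fintype.piFinset fun _ : Fin r => Finset.Icc (-(T : ℤ)) T) ×ˢ P)
    (fun z hz => Finset.mem_product.2 ⟨hb z (hS z hz), hP z hz⟩)
    (fun x hx y hy h => by
      rw [Prod.mk.injEq] at h
      exact ⟨hb' x (hS x hx) y (hS y hy) h.1, by simpa using hdiff x hx y hy h.2⟩)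
  have e : ((T : ℤ) + 1 + (T : ℤ)).toNat = 2 * T + 1 := by omega
  simpa [Finset.card_product, Fintype.card_piFinset, e] using this

/-- Covering the part of a GAP in a rectangle adapted to `w` by balls of radius `‖w‖ / K`. -/
lemma ncard_GAPset_ball_le_mul {r : ℕ} (v : Fin r → ℂ) {L : Fin r → ℝ} (hL : ∀ i, 0 < L i)
    {K : ℝ} (hK : 1 ≤ K) {w : ℂ} (hw : w ≠ 0) {Y : ℝ} (hY : 0 ≤ Y)
    (h : ∀ z ∈ GAPset v L ∩ Metric.closedBall 0 ‖w‖, |(z / w).im| ≤ Y) :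
    ((GAPset v L ∩ Metric.closedBall 0 ‖w‖).ncard : ℝ) ≤
      24 * 3 ^ r * K * (1 + K * Y) *
        ((GAPset v L ∩ Metric.closedBall 0 (‖w‖ / K)).ncard : ℝ) := by
  have hfin := (finite_GAPset v L).inter_of_left (Metric.closedBall 0 ‖w‖)
  have hwpos : 0 < ‖w‖ := norm_pos_iff.2 hw
  have hKpos : 0 < K := by linarith
  have main := ncard_GAPset_ball_le_of_card v hL 1 hfin.toFinset
    (fun z hz => by simpa using ((hfin.mem_toFinset.1 hz).1))
    (fun z => (⌊2 * K * (z / w).re⌋, ⌊2 * K * (z / w).im⌋))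
    (Finset.Icc ⌊-(2 * K)⌋ ⌊2 * K⌋ ×ˢ Finset.Icc ⌊-(2 * K * Y)⌋ ⌊2 * K * Y⌋)
    (fun z hz => by
      have hz' := hfin.mem_toFinset.1 hz
      have h₁ : |(z / w).re| ≤ 1 := by
        refine (Complex.abs_re_le_norm _).trans ?_
        rw [norm_div, div_le_one hwpos]
        simpa using hz'.2
      have h₂ := h z hz'
      rw [abs_le] at h₁ h₂
      simp only [Finset.mem_product, Finset.mem_Icc]
      refine ⟨⟨?_, ?_⟩, ?_, ?_⟩ <;> apply Int.floor_le_floor <;> nlinarith)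
    (ρ := ‖w‖ / K)
    (fun x _ y _ hxy => by
      rw [Prod.mk.injEq] at hxy
      have h₁ := (Int.abs_sub_lt_one_of_floor_eq_floor hxy.1).le
      have h₂ := (Int.abs_sub_lt_one_of_floor_eq_floor hxy.2).le
      rw [← mul_sub, abs_mul, abs_of_pos (by positivity : 0 < 2 * K)] at h₁ h₂
      have h₃ := Complex.norm_le_abs_re_add_abs_im (x / w - y / w)
      rw [Complex.sub_re, Complex.sub_im, ← sub_div, norm_div] at h₃
      rw [le_div_iff₀ hKpos]
      have h₄ : ‖x - y‖ / ‖w‖ * K ≤ 1 := by nlinarith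
      rwa [div_mul_eq_mul_div, div_le_one hwpos] at h₄)
  rw [← Set.ncard_eq_toFinset_card _ hfin, Finset.card_product, Int.card_Icc, Int.card_Icc]
    at main
  have hcount : ∀ t : ℝ, 0 ≤ t → (((⌊t⌋ + 1 - ⌊-t⌋).toNat : ℕ) : ℝ) ≤ 2 * t + 2 := by
    intro t ht
    have h₁ := Int.floor_le t
    have h₂ := Int.lt_floor_add_one (-t)
    have h₃ : ⌊-t⌋ ≤ ⌊t⌋ := Int.floor_le_floor (by linarith)
    have h₄ : (((⌊t⌋ + 1 - ⌊-t⌋).toNat : ℤ) : ℝ) = ⌊t⌋ + 1 - ⌊-t⌋ := by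
      rw [Int.toNat_of_nonneg (by omega)]
      push_cast
      ring
    rw [Int.cast_natCast] at h₄
    rw [h₄]
    linarith
  have h₁ := hcount (2 * K) (by positivity)
  have h₂ := hcount (2 * K * Y) (by positivity)
  have h₃ : (((⌊2 * K⌋ + 1 - ⌊-(2 * K)⌋).toNat : ℕ) : ℝ) *
      (((⌊2 * K * Y⌋ + 1 - ⌊-(2 * K * Y)⌋).toNat : ℕ) : ℝ) ≤ 24 * K * (1 + K * Y) := by
    have hKY : 0 ≤ K * Y := by positivity
    refine (mul_le_mul h₁ h₂ (by positivity) (by positivity)).trans ?_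
    nlinarith [mul_nonneg (sub_nonneg.2 hK) hKY]
  have main' : ((GAPset v L ∩ Metric.closedBall 0 ‖w‖).ncard : ℝ) ≤
      3 ^ r * ((((⌊2 * K⌋ + 1 - ⌊-(2 * K)⌋).toNat : ℕ) : ℝ) *
      (((⌊2 * K * Y⌋ + 1 - ⌊-(2 * K * Y)⌋).toNat : ℕ) : ℝ)) *
        ((GAPset v L ∩ Metric.closedBall 0 (‖w‖ / K)).ncard : ℝ) := by
    exact_mod_cast main
  refine main'.trans ?_
  have := mul_le_mul_of_nonneg_left h₃ (by positivity : (0 : ℝ) ≤ 3 ^ r)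
  refine mul_le_mul_of_nonneg_right (this.trans_eq (by ring)) (by positivity)

/-- The greedy choice of lacunary vectors. -/
lemma exists_lacunary_sequence {r : ℕ} (v : Fin r → ℂ) {L : Fin r → ℝ} (hL : ∀ i, 0 < L i)
    {K : ℝ} (hK : 1 < K) {R : ℝ} (hR : 0 ≤ R) (N : ℕ) :
    ∀ ρ : ℝ, (GAPset v L ∩ Metric.closedBall 0 ρ).ncard ≤ N →
      ∃ (d : ℕ) (w w' : ℕ → ℂ),
        (∀ i < d, w i ∈ GAPset v L ∧ w' i ∈ GAPset v L ∧ R < ‖w i‖ ∧ ‖w' i‖ ≤ ‖w i‖ ∧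
          ‖w i‖ ≤ ρ) ∧
        (∀ i, i + 1 < d → K * ‖w (i + 1)‖ ≤ ‖w i‖) ∧
        ((GAPset v L ∩ Metric.closedBall 0 ρ).ncard : ℝ) ≤
          (∏ i ∈ Finset.range d, 24 * 3 ^ r * K * (1 + K * |(w' i / w i).im|)) *
            ((GAPset v L ∩ Metric.closedBall 0 R).ncard : ℝ) := by
  have hfin : ∀ t, (GAPset v L ∩ Metric.closedBall 0 t).Finite :=
    fun t => (finite_GAPset v L).inter_of_left _
  induction N with
  | zero =>
    intro ρ h
    refine ⟨0, 0, 0, by simp, by simp, ?_⟩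
    rw [Nat.le_zero.1 h]
    simp
  | succ N ih =>
    intro ρ hρ
    by_cases hsub : GAPset v L ∩ Metric.closedBall 0 ρ ⊆ Metric.closedBall 0 R
    · refine ⟨0, 0, 0, by simp, by simp, ?_⟩
      simp only [Finset.range_zero, Finset.prod_empty, one_mul, Nat.cast_le]
      exact Set.ncard_le_ncard (fun z hz => ⟨hz.1, hsub hz⟩) (hfin R)
    obtain ⟨z₀, hz₀, hz₀R⟩ := Set.not_subset.1 hsub
    obtain ⟨w, hw, hwmax⟩ := (hfin ρ).exists_maximalFor (fun z => ‖z‖) _ ⟨z₀, hz₀⟩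
    have hmax : ∀ z ∈ GAPset v L ∩ Metric.closedBall 0 ρ, ‖z‖ ≤ ‖w‖ := fun z hz =>
      (le_total ‖z‖ ‖w‖).elim id fun h => hwmax hz h
    obtain ⟨w', hw', hwmax'⟩ :=
      (hfin ρ).exists_maximalFor (fun z => |(z / w).im|) _ ⟨z₀, hz₀⟩
    have hmax' : ∀ z ∈ GAPset v L ∩ Metric.closedBall 0 ρ,
        |(z / w).im| ≤ |(w' / w).im| := fun z hz =>
      (le_total |(z / w).im| |(w' / w).im|).elim id fun h => hwmax' hz h
    have hRw : R < ‖w‖ := by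
      rw [mem_closedBall_zero_iff, not_le] at hz₀R
      exact hz₀R.trans_le (hmax z₀ hz₀)
    have hwpos : 0 < ‖w‖ := hR.trans_lt hRw
    have hwρ : ‖w‖ ≤ ρ := by simpa using hw.2
    have hball : GAPset v L ∩ Metric.closedBall 0 ρ =
        GAPset v L ∩ Metric.closedBall 0 ‖w‖ := by
      refine Set.Subset.antisymm (fun z hz => ⟨hz.1, by simpa using hmax z hz⟩) fun z hz => ?_
      exact ⟨hz.1, Metric.closedBall_subset_closedBall hwρ hz.2⟩
    have hdivlt : ‖w‖ / K < ‖w‖ := div_lt_self hwpos hK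
    have hlt : (GAPset v L ∩ Metric.closedBall 0 (‖w‖ / K)).ncard <
        (GAPset v L ∩ Metric.closedBall 0 ρ).ncard := by
      refine Set.ncard_lt_ncard (Set.ssubset_iff_exists.2 ⟨?_, w, hw, fun h => ?_⟩) (hfin ρ)
      · exact Set.inter_subset_inter_right _
          (Metric.closedBall_subset_closedBall (hdivlt.le.trans hwρ))
      · have := h.2
        rw [mem_closedBall_zero_iff] at this
        linarith
    obtain ⟨d, W, W', h₁, h₂, h₃⟩ := ih (‖w‖ / K) (by omega)
    refine ⟨d + 1, fun i => Nat.casesOn i w W, fun i => Nat.casesOn i w' W', ?_, ?_, ?_⟩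
    · rintro (_ | i) hi
      · exact ⟨hw.1, hw'.1, hRw, hmax w' hw', hwρ⟩
      · obtain ⟨a, b, c, e, f⟩ := h₁ i (by omega)
        exact ⟨a, b, c, e, f.trans (hdivlt.le.trans hwρ)⟩
    · rintro (_ | i) hi
      · have := (h₁ 0 (by omega)).2.2.2.2
        rw [le_div_iff₀ (by linarith)] at this
        simpa [mul_comm] using this
      · exact h₂ i (by omega)
    · rw [Finset.prod_range_succ']
      have := ncard_GAPset_ball_le_mul v hL hK.le (norm_pos_iff.1 hwpos)
        (abs_nonneg (w' / w).im) (by rwa [← hball])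
      rw [← hball] at this
      refine this.trans ((mul_le_mul_of_nonneg_left h₃ (by positivity)).trans_eq ?_)
      exact (mul_left_comm _ _ _).trans (mul_assoc _ _ _).symm

/-- Sums of few multiples of lacunary elements of a GAP with the elements in a small ball. -/
lemma exists_sums_of_lacunary {r : ℕ} (v : Fin r → ℂ) (L : Fin r → ℝ) (hL : ∀ i, 0 < L i)
    {A : ℕ} (hA : 4 < A) (s : ℕ) (u : ℕ → ℂ) (hu : ∀ j ≤ s, u j ∈ GAPset v L)
    (hpos : ∀ j ≤ s, 0 < ‖u j‖) (hgap : ∀ j < s, (A : ℝ) ^ 2 * ‖u j‖ ≤ ‖u (j + 1)‖) :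
    ∀ j ≤ s, ∃ S : Finset ℂ,
      (∀ z ∈ S, z ∈ GAPset v (((1 + j * A : ℕ) : ℝ) • L)) ∧
      (∀ z ∈ S, ‖z‖ ≤ 2 * A * ‖u j‖) ∧
      S.card = A ^ j * (GAPset v L ∩ Metric.closedBall 0 ‖u 0‖).ncard := by
  classical
  have hA' : (4 : ℝ) < A := by exact_mod_cast hA
  intro j
  induction j with
  | zero =>
    intro _
    have hfin := (finite_GAPset v L).inter_of_left (Metric.closedBall 0 ‖u 0‖)
    refine ⟨hfin.toFinset, fun z hz => ?_, fun z hz => ?_, ?_⟩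
    · simpa using (hfin.mem_toFinset.1 hz).1
    · have h : ‖z‖ ≤ ‖u 0‖ := by simpa using (hfin.mem_toFinset.1 hz).2
      nlinarith [norm_nonneg (u 0)]
    · rw [← Set.ncard_eq_toFinset_card _ hfin, pow_zero, one_mul]
  | succ j ih =>
    intro hj
    obtain ⟨S, hS₁, hS₂, hS₃⟩ := ih (by omega)
    have hg := hgap j (by omega)
    have hp := hpos j (by omega)
    refine ⟨(Finset.range A ×ˢ S).image fun p => (p.1 : ℂ) * u (j + 1) + p.2, ?_, ?_, ?_⟩
    · intro z hz
      obtain ⟨⟨a, q⟩, hp, rfl⟩ := Finset.mem_image.1 hz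
      obtain ⟨ha, hq⟩ := Finset.mem_product.1 hp
      have ha' : (a : ℝ) ≤ A := by exact_mod_cast (Finset.mem_range.1 ha).le
      refine GAPset_mono v (fun i => ?_)
        (add_mem_GAPset (natCast_mul_mem_GAPset (hu _ hj) a) (hS₁ q hq))
      have := mul_le_mul_of_nonneg_right ha' (hL i).le
      simp only [Pi.add_apply, Pi.smul_apply, smul_eq_mul]
      push_cast
      linarith
    · intro z hz
      obtain ⟨⟨a, q⟩, hp, rfl⟩ := Finset.mem_image.1 hz
      obtain ⟨ha, hq⟩ := Finset.mem_product.1 hp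
      have ha' : (a : ℝ) ≤ A := by exact_mod_cast (Finset.mem_range.1 ha).le
      refine (norm_add_le _ _).trans ?_
      rw [norm_mul, Complex.norm_natCast]
      have := mul_le_mul_of_nonneg_right ha' (norm_nonneg (u (j + 1)))
      have := hS₂ q hq
      have h₁ : 2 * A * ‖u j‖ ≤ (A : ℝ) ^ 2 * ‖u j‖ :=
        mul_le_mul_of_nonneg_right (by nlinarith) (norm_nonneg _)
      have h₂ : ‖u (j + 1)‖ ≤ A * ‖u (j + 1)‖ :=
        le_mul_of_one_le_left (norm_nonneg _) (by linarith)
      linarith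
    · rw [Finset.card_image_of_injOn, Finset.card_product, Finset.card_range, hS₃]
      · ring
      · rintro ⟨a, q⟩ h ⟨b, q'⟩ h' heq
        obtain ⟨-, hq⟩ := Finset.mem_product.1 h
        obtain ⟨-, hq'⟩ := Finset.mem_product.1 h'
        dsimp only at heq hq hq'
        have hab : a = b := by
          by_contra hne
          have h₁ : (1 : ℝ) ≤ ‖((a : ℂ) - b)‖ := by
            have : (1 : ℤ) ≤ |(a : ℤ) - b| := Int.one_le_abs (by omega)
            have h₀ : ((a : ℂ) - b) = (((a : ℤ) - b : ℤ) : ℂ) := by push_cast; ring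
            rw [h₀, Complex.norm_intCast]
            exact_mod_cast this
          have h₂ : ((a : ℂ) - b) * u (j + 1) = q' - q := by linear_combination heq
          have h₃ : ‖((a : ℂ) - b)‖ * ‖u (j + 1)‖ ≤ ‖q'‖ + ‖q‖ := by
            rw [← norm_mul, h₂]
            exact norm_sub_le _ _
          have h₄ := hS₂ q hq
          have h₅ := hS₂ q' hq'
          have h₆ := mul_le_mul_of_nonneg_right h₁ (norm_nonneg (u (j + 1)))
          have h₇ : 4 * A * ‖u j‖ < (A : ℝ) ^ 2 * ‖u j‖ := by
            apply mul_lt_mul_of_pos_right _ hp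
            nlinarith
          linarith
        subst hab
        simpa using heq

/-- Many lacunary elements of a GAP force the number of elements in balls to grow. -/
lemma mul_ncard_GAPset_ball_le {r : ℕ} (v : Fin r → ℂ) (L : Fin r → ℝ) (hL : ∀ i, 0 < L i)
    {A : ℕ} (hA : 4 < A) (hA' : (2 * r + 7) ^ r ≤ A) (u : ℕ → ℂ)
    (hu : ∀ j ≤ r + 2, u j ∈ GAPset v L) (hpos : ∀ j ≤ r + 2, 0 < ‖u j‖)
    (hgap : ∀ j < r + 2, (A : ℝ) ^ 2 * ‖u j‖ ≤ ‖u (j + 1)‖) :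
    A * (GAPset v L ∩ Metric.closedBall 0 ‖u 0‖).ncard ≤
      (GAPset v L ∩ Metric.closedBall 0 (4 * A * ‖u (r + 2)‖)).ncard := by
  obtain ⟨S, hS₁, hS₂, hS₃⟩ :=
    exists_sums_of_lacunary v L hL hA (r + 2) u hu hpos hgap (r + 2) le_rfl
  have h := ncard_GAPset_ball_le_of_card v hL _ S hS₁ (fun _ => ()) {()} (by simp)
    (ρ := 4 * A * ‖u (r + 2)‖)
    (fun x hx y hy _ => (norm_sub_le _ _).trans (by linarith [hS₂ x hx, hS₂ y hy]))
  rw [hS₃, Finset.card_singleton, mul_one] at h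
  set n := (GAPset v L ∩ Metric.closedBall 0 ‖u 0‖).ncard
  set N := (GAPset v L ∩ Metric.closedBall 0 (4 * A * ‖u (r + 2)‖)).ncard
  have h₁ : (2 * (1 + (r + 2) * A) + 1) ^ r ≤ A * A ^ r := by
    calc (2 * (1 + (r + 2) * A) + 1) ^ r ≤ ((2 * r + 7) * A) ^ r :=
          Nat.pow_le_pow_left (by nlinarith) r
      _ = (2 * r + 7) ^ r * A ^ r := mul_pow _ _ _
      _ ≤ A * A ^ r := Nat.mul_le_mul_right _ hA'
  have h₂ : A * A ^ r * (A * n) ≤ A * A ^ r * N := by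
    calc A * A ^ r * (A * n) = A ^ (r + 2) * n := by ring
      _ ≤ _ := h
      _ ≤ _ := Nat.mul_le_mul_right _ h₁
  exact Nat.le_of_mul_le_mul_left h₂ (by positivity)

lemma pow_mul_norm_le_of_lacunary {E : Type*} [NormedAddCommGroup E] {K : ℝ} (hK : 0 ≤ K)
    {d : ℕ} {w : ℕ → E} (h : ∀ i, i + 1 < d → K * ‖w (i + 1)‖ ≤ ‖w i‖) (i k : ℕ)
    (hik : i + k < d) : K ^ k * ‖w (i + k)‖ ≤ ‖w i‖ := by
  induction k with
  | zero => simp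
  | succ k ih =>
    refine le_trans ?_ (ih (by omega))
    rw [pow_succ, mul_assoc]
    exact mul_le_mul_of_nonneg_left (h (i + k) hik) (by positivity)

/-- The number of lacunary vectors in a GAP is logarithmic in the ratio of cardinalities. -/
lemma length_le_of_lacunary {r : ℕ} (v : Fin r → ℂ) (L : Fin r → ℝ) (hL : ∀ i, 0 < L i)
    {A : ℕ} (hA : 4 < A) (hA' : (2 * r + 7) ^ r ≤ A) {R : ℝ} (hR : 0 ≤ R) {d : ℕ} {w : ℕ → ℂ}
    (hw : ∀ i < d, w i ∈ GAPset v L) (hwR : ∀ i < d, R < ‖w i‖)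
    (hlac : ∀ i, i + 1 < d → A * ‖w (i + 1)‖ ≤ ‖w i‖) :
    (d : ℝ) ≤ (2 * r + 6) * (1 + Real.log (((GAPset v L).ncard : ℝ) /
      ((GAPset v L ∩ Metric.closedBall 0 R).ncard : ℝ)) / Real.log A) := by
  have hfin : ∀ t, (GAPset v L ∩ Metric.closedBall 0 t).Finite :=
    fun t => (finite_GAPset v L).inter_of_left _
  have hmono : ∀ {s t : ℝ}, s ≤ t → (GAPset v L ∩ Metric.closedBall 0 s).ncard ≤
      (GAPset v L ∩ Metric.closedBall 0 t).ncard := fun h =>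
    Set.ncard_le_ncard
      (Set.inter_subset_inter_right _ (Metric.closedBall_subset_closedBall h)) (hfin _)
  have hA4 : (4 : ℝ) < A := by exact_mod_cast hA
  have hlogA : 0 < Real.log A := Real.log_pos (by linarith)
  have hpow := pow_mul_norm_le_of_lacunary (Nat.cast_nonneg A) hlac
  have hstep : ∀ i, i + (2 * r + 6) < d →
      A * (GAPset v L ∩ Metric.closedBall 0 ‖w (i + (2 * r + 6))‖).ncard ≤
        (GAPset v L ∩ Metric.closedBall 0 ‖w i‖).ncard := by
    intro i hi
    have := mul_ncard_GAPset_ball_le v L hL hA hA' (fun j => w (i + (2 * r + 6) - 2 * j))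
      (fun j hj => hw _ (by omega)) (fun j hj => hR.trans_lt (hwR _ (by omega)))
      (fun j hj => by
        have h := hpow (i + (2 * r + 6) - 2 * (j + 1)) 2 (by omega)
        rwa [show i + (2 * r + 6) - 2 * (j + 1) + 2 = i + (2 * r + 6) - 2 * j by omega] at h)
    refine this.trans (hmono ?_)
    have h := hpow i 2 (by omega)
    rw [show i + (2 * r + 6) - 2 * (r + 2) = i + 2 by omega]
    refine le_trans ?_ h
    exact mul_le_mul_of_nonneg_right (by nlinarith) (norm_nonneg _)
  have hiter : ∀ q, (2 * r + 6) * q < d →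
      A ^ q * (GAPset v L ∩ Metric.closedBall 0 R).ncard ≤ (GAPset v L).ncard := by
    suffices H : ∀ q, (2 * r + 6) * q < d →
        A ^ q * (GAPset v L ∩ Metric.closedBall 0 ‖w ((2 * r + 6) * q)‖).ncard ≤
          (GAPset v L).ncard from fun q hq =>
      (Nat.mul_le_mul_left _ (hmono (hwR _ hq).le)).trans (H q hq)
    intro q
    induction q with
    | zero =>
      intro _
      rw [pow_zero, one_mul]
      exact Set.ncard_le_ncard Set.inter_subset_left (finite_GAPset v L)
    | succ q ih =>
      intro hq
      rw [mul_add, mul_one] at hq ⊢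
      refine le_trans ?_ (ih (by omega))
      rw [pow_succ, mul_assoc]
      exact Nat.mul_le_mul_left _ (hstep _ hq)
  have hn : 0 < (GAPset v L ∩ Metric.closedBall 0 R).ncard :=
    (Set.ncard_pos (hfin R)).2 ⟨0, zero_mem_GAPset v hL, by simpa using hR⟩
  have hn' : (0 : ℝ) < (GAPset v L ∩ Metric.closedBall 0 R).ncard := by exact_mod_cast hn
  rcases Nat.eq_zero_or_pos d with rfl | hd
  · have : (1 : ℝ) ≤ ((GAPset v L).ncard : ℝ) /
        ((GAPset v L ∩ Metric.closedBall 0 R).ncard : ℝ) := by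
      rw [one_le_div hn']
      exact_mod_cast Set.ncard_le_ncard Set.inter_subset_left (finite_GAPset v L)
    have := Real.log_nonneg this
    rw [Nat.cast_zero]
    positivity
  · set q := (d - 1) / (2 * r + 6) with hq
    have h₁ : (2 * r + 6) * q < d := by
      have := Nat.mul_div_le (d - 1) (2 * r + 6)
      rw [← hq] at this
      omega
    have h₂ : d ≤ (2 * r + 6) * (1 + q) := by
      have := Nat.lt_mul_div_succ (d - 1) (show 0 < 2 * r + 6 by omega)
      rw [← hq] at this
      rw [add_comm 1 q]
      omega
    have h₃ : (A : ℝ) ^ q ≤ ((GAPset v L).ncard : ℝ) /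
        ((GAPset v L ∩ Metric.closedBall 0 R).ncard : ℝ) := by
      rw [le_div_iff₀ hn']
      exact_mod_cast hiter q h₁
    have h₄ := Real.log_le_log (by positivity) h₃
    rw [Real.log_pow] at h₄
    have h₅ : (d : ℝ) ≤ (2 * r + 6) * (1 + q) := by exact_mod_cast h₂
    refine h₅.trans (mul_le_mul_of_nonneg_left ?_ (by positivity))
    gcongr
    rwa [le_div_iff₀ hlogA]

/-- **Lacunarity lemma** (Lemma 7.1). -/
theorem lacunarity_lemma (r : ℕ) (hr : 1 ≤ r) :
    ∃ C : ℝ, 0 < C ∧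
      ∀ K : ℝ, 1 ≤ K → ∀ (v : Fin r → ℂ) (L : Fin r → ℝ), (∀ i, 0 < L i) →
      ∀ R : ℝ, 0 ≤ R →
        ∃ (d : ℕ) (w w' : Fin d → ℂ),
          (∀ i, w i ∈ GAPset v L) ∧ (∀ i, w' i ∈ GAPset v L) ∧
          -- (i) lacunarity
          (∀ i j : Fin d, (j : ℕ) = (i : ℕ) + 1 → K * ‖w j‖ ≤ ‖w i‖) ∧
          -- (ii) secondary bounds
          (∀ i, R < ‖w i‖) ∧ (∀ i, ‖w' i‖ ≤ ‖w i‖) ∧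
          -- (iii) many vectors
          (((GAPset v L).ncard : ℝ)
            ≤ (∏ i, C * K * (1 + K * |(w' i / w i).im|))
              * ((GAPset v L ∩ Metric.closedBall 0 R).ncard : ℝ)) ∧
          -- (iv) crude upper bound
          ((d : ℝ) ≤ C * (1 + Real.log (((GAPset v L).ncard : ℝ)
                / ((GAPset v L ∩ Metric.closedBall 0 R).ncard : ℝ))
              / Real.log (max K 2))) := by
  set M : ℕ := (2 * r + 7) ^ r + 5
  have hM5 : 5 ≤ M := by omega
  have hM5' : (5 : ℝ) ≤ M := by exact_mod_cast hM5
  refine ⟨max (24 * 3 ^ r * (M + 2) ^ 2) (2 * r + 6), by positivity, ?_⟩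
  set C : ℝ := max (24 * 3 ^ r * (M + 2) ^ 2) (2 * r + 6)
  intro K hK v L hL R hR
  set A : ℕ := ⌈K⌉₊ + M with hA
  have hKA : K ≤ A := by
    have := Nat.le_ceil K
    rw [hA]
    push_cast
    linarith
  have hMA : (M : ℝ) ≤ A := by exact_mod_cast Nat.le_add_left M _
  have hAK : (A : ℝ) ≤ (M + 2) * K := by
    have := (Nat.ceil_lt_add_one (show 0 ≤ K by linarith)).le
    rw [hA]
    push_cast
    nlinarith
  obtain ⟨ρ, hρ⟩ := (finite_GAPset v L).isBounded.subset_closedBall 0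
  obtain ⟨d, w, w', h₁, h₂, h₃⟩ := exists_lacunary_sequence v hL
    (show (1 : ℝ) < A by linarith) hR _ ρ le_rfl
  rw [Set.inter_eq_left.2 hρ] at h₃
  refine ⟨d, fun i => w i, fun i => w' i, fun i => (h₁ i i.2).1, fun i => (h₁ i i.2).2.1,
    fun i j hij => ?_, fun i => (h₁ i i.2).2.2.1, fun i => (h₁ i i.2).2.2.2.1, ?_, ?_⟩
  · have := h₂ i (by omega)
    rw [← hij] at this
    exact (mul_le_mul_of_nonneg_right hKA (norm_nonneg _)).trans this
  · rw [Fin.prod_univ_eq_prod_range (fun i => C * K * (1 + K * |(w' i / w i).im|)) d]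
    refine h₃.trans (mul_le_mul_of_nonneg_right ?_ (by positivity))
    refine Finset.prod_le_prod (fun i _ => by positivity) fun i _ => ?_
    set Y := |(w' i / w i).im|
    have hY : 0 ≤ Y := abs_nonneg _
    calc 24 * 3 ^ r * (A : ℝ) * (1 + A * Y)
        ≤ 24 * 3 ^ r * ((M + 2) * K) * ((M + 2) * (1 + K * Y)) := by
          gcongr
          nlinarith [mul_le_mul_of_nonneg_right hAK hY]
      _ = 24 * 3 ^ r * (M + 2) ^ 2 * K * (1 + K * Y) := by ring
      _ ≤ C * K * (1 + K * Y) := by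
          gcongr
          exact le_max_left _ _
  · have h := length_le_of_lacunary v L hL (A := A) (by omega) (by omega) hR
      (fun i hi => (h₁ i hi).1) (fun i hi => (h₁ i hi).2.2.1) h₂
    have hfin := (finite_GAPset v L).inter_of_left (Metric.closedBall 0 R)
    have hn : (0 : ℝ) < (GAPset v L ∩ Metric.closedBall 0 R).ncard := by
      exact_mod_cast (Set.ncard_pos hfin).2 ⟨0, zero_mem_GAPset v hL, by simpa using hR⟩
    have hratio : (1 : ℝ) ≤ ((GAPset v L).ncard : ℝ) /
        ((GAPset v L ∩ Metric.closedBall 0 R).ncard : ℝ) := by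
      rw [one_le_div hn]
      exact_mod_cast Set.ncard_le_ncard Set.inter_subset_left (finite_GAPset v L)
    have hlog := Real.log_nonneg hratio
    have hlogK : 0 < Real.log (max K 2) := Real.log_pos (by simp)
    have hle : Real.log (max K 2) ≤ Real.log A :=
      Real.log_le_log (by positivity) (max_le hKA (by linarith))
    refine h.trans ?_
    gcongr
    exact le_max_right _ _
end
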